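/- arXiv:1806.07225 — 3 statements merged into one kernel-verified Lean document; each statement's English description precedes it below -/
import Mathlib

section
/- Let Ω be an infinite compact subset of ℝ^p. Suppose there exist d ∈ ℕ and constants 0 < C_* ≤ C^* < ∞ such that liminf_{n→∞} n^{1/d} δ_n(Ω) = C_* and limsup_{n→∞} n^{1/d} δ_n(Ω) = C^*. If 0 < r < C_* and R > C^*, then for every sufficiently large n ∈ ℕ there exists an n-point set X_n ⊂ Ω such that |x_i − x_j| ≥ r n^{−1/d} for all i ≠ j and X_n intersects the closed ball of radius R n^{−1/d} around every point y ∈ Ω. -/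
noncomputable section

open MeasureTheory Metric Set Filter
open scoped ENNReal NNReal Topology

/-- The `n`-point best-packing distance on `Ω`: the supremum of separation distances of
`n`-point configurations contained in `Ω`. -/
def bestPackingDist {p : ℕ} (Ω : Set (EuclideanSpace ℝ (Fin p))) (n : ℕ) : ℝ :=
  sSup { s : ℝ | ∃ x : Fin n → EuclideanSpace ℝ (Fin p),
    (∀ i, x i ∈ Ω) ∧ Function.Injective x ∧
    ∀ i j, i ≠ j → s ≤ dist (x i) (x j) }

/-- Replacement argument: minimise the number of close pairs. -/
lemma exists_packing_cover {p n : ℕ} (Ω : Set (EuclideanSpace ℝ (Fin p)))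
    (hΩcomp : IsCompact Ω) (hn : 2 ≤ n) (s ρ : ℝ) (hs : 0 < s) (hs1 : s < bestPackingDist Ω n)
    (hρ : bestPackingDist Ω n < ρ) :
    ∃ x : Fin n → EuclideanSpace ℝ (Fin p), (∀ i, x i ∈ Ω) ∧
      (∀ i j, i ≠ j → s ≤ dist (x i) (x j)) ∧ (∀ y ∈ Ω, ∃ i, dist y (x i) ≤ ρ) := by
  classical
  set S : Set ℝ := { s : ℝ | ∃ x : Fin n → EuclideanSpace ℝ (Fin p),
    (∀ i, x i ∈ Ω) ∧ Function.Injective x ∧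
    ∀ i j, i ≠ j → s ≤ dist (x i) (x j) } with hS
  have hdef : bestPackingDist Ω n = sSup S := rfl
  have hbdd : BddAbove S := by
    refine ⟨Metric.diam Ω, ?_⟩
    rintro t ⟨x, hx, -, ht⟩
    have hne : (⟨0, by omega⟩ : Fin n) ≠ ⟨1, by omega⟩ := by simp
    exact (ht _ _ hne).trans (Metric.dist_le_diam_of_mem hΩcomp.isBounded (hx _) (hx _))
  have hSne : S.Nonempty := by
    by_contra h
    rw [Set.not_nonempty_iff_eq_empty] at h
    rw [hdef, h, Real.sSup_empty] at hs1
    linarith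
  let bad : (Fin n → EuclideanSpace ℝ (Fin p)) → Finset (Fin n × Fin n) := fun x =>
    Finset.univ.filter (fun q => q.1 ≠ q.2 ∧ dist (x q.1) (x q.2) < ρ)
  have key : ∀ k : ℕ, ∀ x : Fin n → EuclideanSpace ℝ (Fin p), (bad x).card = k →
      (∀ i, x i ∈ Ω) → (∀ i j, i ≠ j → s ≤ dist (x i) (x j)) →
      ∃ x : Fin n → EuclideanSpace ℝ (Fin p), (∀ i, x i ∈ Ω) ∧
      (∀ i j, i ≠ j → s ≤ dist (x i) (x j)) ∧ (∀ y ∈ Ω, ∃ i, dist y (x i) ≤ ρ) := by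
    intro k
    induction k using Nat.strong_induction_on with
    | _ k ih =>
    intro x hk hx hsep
    by_cases hcov : ∀ y ∈ Ω, ∃ i, dist y (x i) ≤ ρ
    · exact ⟨x, hx, hsep, hcov⟩
    push Not at hcov
    obtain ⟨y, hy, hyd⟩ := hcov
    have hinj : Function.Injective x := by
      intro i j hij
      by_contra hne
      have := hsep i j hne
      rw [hij, dist_self] at this
      linarith
    have hpair : ∃ a b, a ≠ b ∧ dist (x a) (x b) < ρ := by
      by_contra hcon
      push Not at hcon
      have : ρ ≤ sSup S := le_csSup hbdd ⟨x, hx, hinj, hcon⟩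
      linarith
    obtain ⟨a, b, hab, habd⟩ := hpair
    have hsub : bad (Function.update x a y) ⊂ bad x := by
      rw [Finset.ssubset_iff_of_subset]
      · refine ⟨(a, b), by simp [bad, hab, habd], ?_⟩
        have := hyd b
        simp [bad, Function.update_of_ne hab.symm, this.le]
      · rintro ⟨i, j⟩ hij
        simp only [bad, Finset.mem_filter, Finset.mem_univ, true_and] at hij ⊢
        obtain ⟨hne, hlt⟩ := hij
        refine ⟨hne, ?_⟩
        by_cases hi : i = a
        · subst hi
          rw [Function.update_self, Function.update_of_ne hne.symm] at hlt
          exact absurd (hyd j) (not_lt.2 hlt.le)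
        by_cases hj : j = a
        · subst hj
          rw [Function.update_self, Function.update_of_ne hne, dist_comm] at hlt
          exact absurd (hyd i) (not_lt.2 hlt.le)
        rwa [Function.update_of_ne hi, Function.update_of_ne hj] at hlt
    refine ih _ (hk ▸ Finset.card_lt_card hsub) _ rfl ?_ ?_
    · intro i
      by_cases hi : i = a
      · subst hi; simpa using hy
      · rw [Function.update_of_ne hi]; exact hx i
    · intro i j hne
      by_cases hi : i = a
      · subst hi
        rw [Function.update_self, Function.update_of_ne hne.symm]
        linarith [hyd j]
      by_cases hj : j = a
      · subst hj
        rw [Function.update_self, Function.update_of_ne hne, dist_comm]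
        linarith [hyd i]
      rw [Function.update_of_ne hi, Function.update_of_ne hj]
      exact hsep i j hne
  obtain ⟨t, ⟨x, hx, -, ht⟩, hst⟩ := exists_lt_of_lt_csSup hSne (hdef ▸ hs1)
  exact key _ x rfl hx (fun i j hij => hst.le.trans (ht i j hij))

lemma bestPackingDist_nonneg {p : ℕ} (Ω : Set (EuclideanSpace ℝ (Fin p)))
    (hΩinf : Ω.Infinite) (n : ℕ) : 0 ≤ bestPackingDist Ω n := by
  have := hΩinf.to_subtype
  obtain ⟨f⟩ : Nonempty (Fin n ↪ Ω) := ⟨Fin.valEmbedding.trans (Infinite.natEmbedding Ω)⟩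
  refine Real.sSup_nonneg' ⟨0, ⟨fun i => f i, fun i => (f i).2, ?_, fun i j _ => dist_nonneg⟩,
    le_rfl⟩
  exact Subtype.val_injective.comp f.injective

/-- If `liminf n^{1/d} δ_n(Ω) = C_*` and `limsup n^{1/d} δ_n(Ω) = C^*`
with `0 < C_* ≤ C^*`, and `0 < r < C_*`, `R > C^*`, then for all sufficiently large `n`
there is an `n`-point configuration in `Ω` with pairwise distances at least `r n^{-1/d}`
which meets the closed ball of radius `R n^{-1/d}` around every point of `Ω`. -/
theorem stmt_0 {p : ℕ} (Ω : Set (EuclideanSpace ℝ (Fin p)))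
    (hΩinf : Ω.Infinite) (hΩcomp : IsCompact Ω)
    (d : ℕ) (hd : 0 < d) (Cstar Cstar' : ℝ)
    (hC0 : 0 < Cstar) (hCle : Cstar ≤ Cstar')
    (hliminf : Filter.liminf
      (fun n : ℕ => (n : ℝ) ^ ((1:ℝ)/d) * bestPackingDist Ω n) Filter.atTop = Cstar)
    (hlimsup : Filter.limsup
      (fun n : ℕ => (n : ℝ) ^ ((1:ℝ)/d) * bestPackingDist Ω n) Filter.atTop = Cstar')
    (r R : ℝ) (hr : 0 < r) (hrC : r < Cstar) (hRC : Cstar' < R) :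
    ∀ᶠ n : ℕ in Filter.atTop, ∃ x : Fin n → EuclideanSpace ℝ (Fin p),
      (∀ i, x i ∈ Ω) ∧
      (∀ i j, i ≠ j → r * (n : ℝ) ^ (-(1:ℝ)/d) ≤ dist (x i) (x j)) ∧
      (∀ y ∈ Ω, ∃ i, dist y (x i) ≤ R * (n : ℝ) ^ (-(1:ℝ)/d)) := by
  set u : ℕ → ℝ := fun n : ℕ => (n : ℝ) ^ ((1:ℝ)/d) * bestPackingDist Ω n with hu
  have hu0 : ∀ n, 0 ≤ u n := fun n =>
    mul_nonneg (by positivity) (bestPackingDist_nonneg Ω hΩinf n)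
  have hbelow : Filter.IsBoundedUnder (· ≥ ·) Filter.atTop u :=
    Filter.isBoundedUnder_of ⟨0, hu0⟩
  have habove : Filter.IsBoundedUnder (· ≤ ·) Filter.atTop u := by
    by_contra h
    have hempty : {a : ℝ | ∀ᶠ n in Filter.atTop, u n ≤ a} = ∅ := by
      rw [Set.eq_empty_iff_forall_notMem]
      intro a ha
      exact h ⟨a, by simpa using ha⟩
    rw [Filter.limsup_eq, hempty, Real.sInf_empty] at hlimsup
    linarith
  have h1 := Filter.eventually_lt_of_lt_liminf (hliminf.symm ▸ hrC) hbelow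
  have h2 := Filter.eventually_lt_of_limsup_lt (hlimsup.symm ▸ hRC) habove
  filter_upwards [h1, h2, Filter.eventually_ge_atTop 2] with n hn1 hn2 hn
  have hnpos : (0:ℝ) < n := by exact_mod_cast (by omega : 0 < n)
  have hpos : (0:ℝ) < (n:ℝ) ^ ((1:ℝ)/d) := Real.rpow_pos_of_pos hnpos _
  have hneg : (n:ℝ) ^ (-(1:ℝ)/d) = ((n:ℝ) ^ ((1:ℝ)/d))⁻¹ := by
    rw [neg_div, Real.rpow_neg hnpos.le]
  rw [hneg, ← div_eq_mul_inv, ← div_eq_mul_inv]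
  apply exists_packing_cover Ω hΩcomp hn
  · positivity
  · rw [div_lt_iff₀ hpos, mul_comm]; exact hn1
  · rw [lt_div_iff₀ hpos, mul_comm]; exact hn2

end
end

section
/- Suppose Ω is an infinite compact subset of ℝ^p whose topology has a basis of open sets {U_α}_{α∈I} such that h_d(∂U_α) = P_d(∂U_α) = 0 (boundary taken in Ω) and P_d(U_α) = h_d(U_α) for all α ∈ I. Fix r, R > 0, and for each n ∈ {2,3,…} let X_n ⊂ Ω be an n-point set satisfying |x_i − x_j| ≥ r n^{−1/d} for i ≠ j and intersecting the closed ball of radius R n^{−1/d} around every point of Ω; let ν_n := (1/n) Σ_{j=1}^n δ_{x_j}. Then every weak-* limit point of the sequence {ν_n}_{n≥2} is mutually absolutely continuous with respect to d-dimensional Hausdorff measure on Ω. -/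
noncomputable section

open MeasureTheory Metric Set Filter
open scoped ENNReal NNReal Topology

/-- `P_d(X, δ)`: the supremum of `∑ (diam B_n)^d` over finite or countable families of
pairwise disjoint closed balls with centers in `X` and diameters at most `δ`. -/
def packingPremeasureAt {p : ℕ} (d : ℕ) (X : Set (EuclideanSpace ℝ (Fin p))) (δ : ℝ) : ℝ≥0∞ :=
  sSup { m : ℝ≥0∞ | ∃ (s : Set ℕ) (c : ℕ → EuclideanSpace ℝ (Fin p)) (rad : ℕ → ℝ),
    (∀ i ∈ s, c i ∈ X ∧ 0 ≤ rad i ∧ 2 * rad i ≤ δ) ∧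
    (s.Pairwise fun i j => Disjoint (closedBall (c i) (rad i)) (closedBall (c j) (rad j))) ∧
    m = ∑' i : s, (ENNReal.ofReal (2 * rad (i : ℕ))) ^ d }

/-- The `d`-dimensional packing premeasure `P_d(X) = lim_{δ → 0⁺} P_d(X, δ)`; since
`δ ↦ P_d(X, δ)` is monotone, the limit equals the infimum over `δ > 0`. -/
def packingPremeasure {p : ℕ} (d : ℕ) (X : Set (EuclideanSpace ℝ (Fin p))) : ℝ≥0∞ :=
  ⨅ (δ : ℝ) (_ : 0 < δ), packingPremeasureAt d X δ

/-- The empirical measure `ν_n = (1/n) ∑ δ_{x_j}` of a configuration. -/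
def empiricalMeasure {α : Type} [MeasurableSpace α] {n : ℕ} (x : Fin n → α) : Measure α :=
  ((n : ℝ≥0∞))⁻¹ • ∑ i : Fin n, Measure.dirac (x i)

lemma ediam_closedBall_le' {p : ℕ} (c : EuclideanSpace ℝ (Fin p)) (ρ : ℝ) :
    ediam (closedBall c ρ) ≤ ENNReal.ofReal (2 * ρ) := by
  refine ediam_le fun a ha b hb => ?_
  rw [edist_dist]
  apply ENNReal.ofReal_le_ofReal
  have h1 := mem_closedBall.1 ha
  have h2 := mem_closedBall.1 hb
  have := dist_triangle_right a b c
  linarith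

lemma ediam_closedBall_pow_le {p : ℕ} (d : ℕ) (c : EuclideanSpace ℝ (Fin p)) (ρ : ℝ) :
    ediam (closedBall c ρ) ^ (d : ℝ) ≤ (ENNReal.ofReal (2 * ρ)) ^ d := by
  rw [ENNReal.rpow_natCast]
  exact pow_le_pow_left' (ediam_closedBall_le' c ρ) d

lemma le_packingAt {p : ℕ} (d : ℕ) (X : Set (EuclideanSpace ℝ (Fin p))) (δ : ℝ)
    {ι : Type} [Countable ι] (c : ι → EuclideanSpace ℝ (Fin p)) (rad : ι → ℝ)
    (h1 : ∀ i, c i ∈ X ∧ 0 ≤ rad i ∧ 2 * rad i ≤ δ)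
    (h2 : Pairwise fun i j => Disjoint (closedBall (c i) (rad i)) (closedBall (c j) (rad j))) :
    ∑' i, (ENNReal.ofReal (2 * rad i)) ^ d ≤ packingPremeasureAt d X δ := by
  classical
  obtain ⟨f, hf⟩ := exists_injective_nat ι
  apply le_sSup
  refine ⟨range f, Function.extend f c (fun _ => 0), Function.extend f rad (fun _ => 0), ?_, ?_, ?_⟩
  · rintro _ ⟨i, rfl⟩
    rw [hf.extend_apply, hf.extend_apply]
    exact h1 i
  · rintro _ ⟨i, rfl⟩ _ ⟨j, rfl⟩ hij
    rw [hf.extend_apply, hf.extend_apply, hf.extend_apply, hf.extend_apply]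
    exact h2 (fun h => hij (by rw [h]))
  · rw [tsum_range (g := f) (fun n => (ENNReal.ofReal (2 * Function.extend f rad (fun _ => 0) n)) ^ d) hf]
    simp only [hf.extend_apply]

lemma packingAt_mono {p : ℕ} (d : ℕ) {X Y : Set (EuclideanSpace ℝ (Fin p))} (hXY : X ⊆ Y)
    {δ δ' : ℝ} (h : δ ≤ δ') : packingPremeasureAt d X δ ≤ packingPremeasureAt d Y δ' := by
  apply sSup_le_sSup
  rintro m ⟨s, c, rad, h1, h2, h3⟩
  exact ⟨s, c, rad, fun i hi => ⟨hXY (h1 i hi).1, (h1 i hi).2.1, (h1 i hi).2.2.trans h⟩, h2, h3⟩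

lemma packing_superadd {p : ℕ} (d : ℕ) {K L V : Set (EuclideanSpace ℝ (Fin p))}
    (hK : K ⊆ V) (hL : L ⊆ V) {ε : ℝ} (hε : 0 < ε) (hd : ∀ a ∈ K, ∀ b ∈ L, ε ≤ dist a b) :
    packingPremeasure d K + packingPremeasure d L ≤ packingPremeasure d V := by
  refine le_iInf₂ fun δ hδ => ?_
  set δ' := min δ (ε / 2) with hδ'
  have hδ'0 : 0 < δ' := lt_min hδ (by positivity)
  have h1 : packingPremeasure d K ≤ packingPremeasureAt d K δ' := iInf₂_le δ' hδ'0
  have h2 : packingPremeasure d L ≤ packingPremeasureAt d L δ' := iInf₂_le δ' hδ'0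
  refine (add_le_add h1 h2).trans (le_trans ?_ (packingAt_mono d subset_rfl (min_le_left δ (ε/2))))
  have hcomb : ∀ m1 m2 : ℝ≥0∞, (∃ (s : Set ℕ) (c : ℕ → EuclideanSpace ℝ (Fin p)) (rad : ℕ → ℝ),
      (∀ i ∈ s, c i ∈ K ∧ 0 ≤ rad i ∧ 2 * rad i ≤ δ') ∧
      (s.Pairwise fun i j => Disjoint (closedBall (c i) (rad i)) (closedBall (c j) (rad j))) ∧
      m1 = ∑' i : s, (ENNReal.ofReal (2 * rad (i : ℕ))) ^ d) →
      (∃ (s : Set ℕ) (c : ℕ → EuclideanSpace ℝ (Fin p)) (rad : ℕ → ℝ),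
      (∀ i ∈ s, c i ∈ L ∧ 0 ≤ rad i ∧ 2 * rad i ≤ δ') ∧
      (s.Pairwise fun i j => Disjoint (closedBall (c i) (rad i)) (closedBall (c j) (rad j))) ∧
      m2 = ∑' i : s, (ENNReal.ofReal (2 * rad (i : ℕ))) ^ d) →
      m1 + m2 ≤ packingPremeasureAt d V δ' := by
    rintro m1 m2 ⟨s, c, rad, a1, a2, rfl⟩ ⟨s', c', rad', b1, b2, rfl⟩
    have hdis : ∀ i ∈ s, ∀ j ∈ s',
        Disjoint (closedBall (c i) (rad i)) (closedBall (c' j) (rad' j)) := by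
      intro i hi j hj
      apply closedBall_disjoint_closedBall
      have := hd _ (a1 i hi).1 _ (b1 j hj).1
      have h3 := (a1 i hi).2.2
      have h4 := (b1 j hj).2.2
      have h5 : δ' ≤ ε / 2 := min_le_right _ _
      linarith
    have key := le_packingAt d V δ' (ι := s ⊕ s')
      (Sum.elim (fun i => c i) (fun i => c' i)) (Sum.elim (fun i => rad i) (fun i => rad' i)) ?_ ?_
    · refine le_trans (le_of_eq ?_) key
      rw [Summable.tsum_sum (f := fun i : s ⊕ s' => _) ENNReal.summable ENNReal.summable]
      simp
    · rintro (i | i)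
      · exact ⟨hK (a1 i i.2).1, (a1 i i.2).2⟩
      · exact ⟨hL (b1 i i.2).1, (b1 i i.2).2⟩
    · rintro (i | i) (j | j) hij
      · exact a2 i.2 j.2 (fun h => hij (by rw [Subtype.ext h]))
      · exact hdis i i.2 j j.2
      · exact (hdis j j.2 i i.2).symm
      · exact b2 i.2 j.2 (fun h => hij (by rw [Subtype.ext h]))
  have hemp : ∀ X : Set (EuclideanSpace ℝ (Fin p)), ∃ m : ℝ≥0∞,
     (∃ (s : Set ℕ) (c : ℕ → EuclideanSpace ℝ (Fin p)) (rad : ℕ → ℝ),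
      (∀ i ∈ s, c i ∈ X ∧ 0 ≤ rad i ∧ 2 * rad i ≤ δ') ∧
      (s.Pairwise fun i j => Disjoint (closedBall (c i) (rad i)) (closedBall (c j) (rad j))) ∧
      m = ∑' i : s, (ENNReal.ofReal (2 * rad (i : ℕ))) ^ d) :=
    fun X => ⟨_, ∅, fun _ => 0, fun _ => 0, by simp, by simp, rfl⟩
  rw [packingPremeasureAt.eq_def d K, packingPremeasureAt.eq_def d L, sSup_eq_iSup, sSup_eq_iSup]
  exact ENNReal.biSup_add_biSup_le' (hemp K) (hemp L) (fun m1 h1 m2 h2 => hcomb m1 m2 h1 h2)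

lemma hausdorff_cover {p : ℕ} (d : ℕ) (A : Set (EuclideanSpace ℝ (Fin p))) {δ : ℝ} (hδ : 0 < δ)
    (hfin : packingPremeasureAt d A δ ≠ ⊤) {ε : ℝ≥0∞} (hε : ε ≠ 0) :
    ∃ (ι : Type) (_ : Countable ι) (t : ι → Set (EuclideanSpace ℝ (Fin p))),
      A ⊆ ⋃ i, t i ∧ (∀ i, ediam (t i) ≤ ENNReal.ofReal (3 * δ)) ∧
      ∑' i, ediam (t i) ^ (d : ℝ) ≤ packingPremeasureAt d A δ + ε := by
  classical
  obtain ⟨u, hut, hdis, hcov⟩ := Vitali.exists_disjoint_subfamily_covering_enlargement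
    (fun q : EuclideanSpace ℝ (Fin p) × ℝ => closedBall q.1 q.2)
    {q | q.1 ∈ A ∧ 0 < q.2 ∧ 2 * q.2 ≤ δ} (fun q => q.2) 2 one_lt_two
    (fun q hq => hq.2.1.le) δ (fun q hq => by have := hq.2.1; have := hq.2.2; linarith)
    (fun q hq => nonempty_closedBall.2 hq.2.1.le)
  have hcount : u.Countable := hdis.countable_of_nonempty_interior (fun q hq =>
    ⟨q.1, ball_subset_interior_closedBall (mem_ball_self (hut hq).2.1)⟩)
  have : Countable u := hcount.to_subtype
  have hsum : ∑' q : u, (ENNReal.ofReal (2 * q.1.2)) ^ d ≤ packingPremeasureAt d A δ := by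
    apply le_packingAt d A δ (fun q : u => q.1.1) (fun q : u => q.1.2)
    · exact fun q => ⟨(hut q.2).1, (hut q.2).2.1.le, (hut q.2).2.2⟩
    · exact fun i j hij => hdis i.2 j.2 (fun h => hij (Subtype.ext h))
  have hsumfin : ∑' q : u, (ENNReal.ofReal (2 * q.1.2)) ^ d ≠ ⊤ := ne_top_of_le_ne_top hfin hsum
  have htail := ENNReal.tendsto_tsum_compl_atTop_zero hsumfin
  have hε' : (0 : ℝ≥0∞) < ε / 3 ^ d := ENNReal.div_pos hε (by finiteness)
  obtain ⟨F, hF⟩ := ((tendsto_order.1 htail).2 _ hε').exists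
  refine ⟨u, this, fun q => closedBall q.1.1 (if q ∈ F then q.1.2 else 3 * q.1.2), ?_, ?_, ?_⟩
  · intro a ha
    by_cases haF : ∃ q ∈ F, a ∈ closedBall q.1.1 q.1.2
    · obtain ⟨q, hq, haq⟩ := haF
      exact mem_iUnion.2 ⟨q, by simpa [hq] using haq⟩
    · have hcl : IsClosed (⋃ q ∈ F, closedBall q.1.1 q.1.2) :=
        F.finite_toSet.isClosed_biUnion (fun q _ => isClosed_closedBall)
      have hmem : (⋃ q ∈ F, closedBall q.1.1 q.1.2)ᶜ ∈ 𝓝 a := by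
        apply hcl.isOpen_compl.mem_nhds
        simp only [mem_compl_iff, mem_iUnion, not_exists]
        intro q hq h
        exact haF ⟨q, hq, h⟩
      obtain ⟨ρ, hρ, hsub⟩ := Metric.nhds_basis_closedBall.mem_iff.1 hmem
      have hρ' : 0 < min ρ (δ / 2) := lt_min hρ (by positivity)
      obtain ⟨b, hbu, ⟨z, hz1, hz2⟩, hle⟩ := hcov (a, min ρ (δ / 2))
        ⟨ha, hρ', by have := min_le_right ρ (δ/2); simp only; linarith⟩
      simp only at hz1 hz2 hle
      have hbF : (⟨b, hbu⟩ : u) ∉ F := by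
        intro h
        have h1 := hsub (closedBall_subset_closedBall (min_le_left _ _) hz1)
        exact h1 (mem_biUnion h hz2)
      refine mem_iUnion.2 ⟨⟨b, hbu⟩, ?_⟩
      simp only [hbF, if_false, mem_closedBall] at *
      have := dist_triangle_left a b.1 z
      linarith
  · intro q
    have h0 := (hut q.2).2.1
    have h1 := (hut q.2).2.2
    refine (ediam_closedBall_le' _ _).trans (ENNReal.ofReal_le_ofReal ?_)
    split_ifs <;> linarith
  · have hdiam := ediam_closedBall_pow_le (p := p) d
    calc ∑' q : u, ediam (closedBall q.1.1 (if q ∈ F then q.1.2 else 3 * q.1.2)) ^ (d:ℝ)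
        ≤ ∑' q : u, ((ENNReal.ofReal (2 * q.1.2)) ^ d +
            indicator {q : u | q ∉ F} (fun q => 3 ^ d * (ENNReal.ofReal (2 * q.1.2)) ^ d) q) := by
          refine ENNReal.tsum_le_tsum fun q => ?_
          have h0 := (hut q.2).2.1
          by_cases hq : q ∈ F
          · simpa [hq] using hdiam _ _
          · simp only [hq, if_false, mem_ofPred_eq, not_false_eq_true, indicator_of_mem]
            refine (hdiam _ _).trans (le_trans (le_of_eq ?_) le_add_self)
            rw [← mul_pow, show (2 * (3 * q.1.2)) = 3 * (2 * q.1.2) by ring,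
              ENNReal.ofReal_mul (by norm_num)]
            simp
      _ = ∑' q : u, (ENNReal.ofReal (2 * q.1.2)) ^ d +
          3 ^ d * ∑' q : {q : u // q ∉ F}, (ENNReal.ofReal (2 * q.1.1.2)) ^ d := by
          rw [ENNReal.tsum_add, ← tsum_subtype, ENNReal.tsum_mul_left]
          rfl
      _ ≤ _ := by
          gcongr
          refine (mul_le_mul_right hF.le _).trans ?_
          exact ENNReal.mul_div_le

lemma hausdorff_le_packing {p : ℕ} (d : ℕ) (A : Set (EuclideanSpace ℝ (Fin p))) :
    μH[d] A ≤ packingPremeasure d A := by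
  refine le_iInf₂ fun δ hδ => ?_
  by_cases hfin : packingPremeasureAt d A δ = ⊤
  · simp [hfin]
  refine ENNReal.le_of_forall_pos_le_add fun ε hε _ => ?_
  have hle : ∀ n : ℕ, δ / (n + 1) ≤ δ := fun n => div_le_self hδ.le (by
    have : (0:ℝ) ≤ n := by positivity
    linarith)
  have H : ∀ n : ℕ, _ := fun n => hausdorff_cover d A (δ := δ / (n + 1)) (by positivity)
    (ne_top_of_le_ne_top hfin (packingAt_mono d subset_rfl (hle n))) (ε := ε) (by positivity)
  choose ι hι t h1 h2 h3 using H
  refine (Measure.hausdorffMeasure_le_liminf_tsum (d:ℝ) A (l := atTop)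
    (fun n : ℕ => ENNReal.ofReal (3 * (δ / (n + 1)))) ?_ t (Eventually.of_forall h2)
      (Eventually.of_forall h1)).trans ?_
  · rw [← ENNReal.ofReal_zero]
    apply ENNReal.tendsto_ofReal
    have := (tendsto_one_div_add_atTop_nhds_zero_nat (𝕜 := ℝ)).const_mul (3 * δ)
    simp only [mul_zero] at this
    refine this.congr fun n => by ring
  · refine liminf_le_of_le (by isBoundedDefault) fun b hb => ?_
    obtain ⟨n, hn⟩ := hb.exists
    refine hn.trans ((h3 n).trans ?_)
    gcongr
    exact packingAt_mono d subset_rfl (hle n)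

lemma emp_apply {p n : ℕ} (x : Fin n → EuclideanSpace ℝ (Fin p))
    (A : Set (EuclideanSpace ℝ (Fin p))) :
    empiricalMeasure x A = (n : ℝ≥0∞)⁻¹ * (Nat.card {i // x i ∈ A} : ℝ≥0∞) := by
  classical
  simp only [empiricalMeasure, Measure.smul_apply, Measure.finsetSum_apply, Measure.dirac_apply,
    smul_eq_mul]
  congr 1
  simp [Set.indicator_apply, Nat.card_eq_fintype_card, Fintype.card_subtype]

lemma ofReal_scale_pow {d n : ℕ} (hd : 0 < d) (hn : 2 ≤ n) {a : ℝ} (ha : 0 < a) :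
    (ENNReal.ofReal (a * (n : ℝ) ^ (-(1:ℝ)/d))) ^ d = ENNReal.ofReal (a ^ d) * (n : ℝ≥0∞)⁻¹ := by
  have hn0 : (0 : ℝ) < n := by positivity
  rw [← ENNReal.ofReal_pow (by positivity), mul_pow, ENNReal.ofReal_mul (by positivity)]
  congr 1
  rw [← Real.rpow_natCast, ← Real.rpow_mul hn0.le, div_mul_cancel₀ _ (by positivity),
    Real.rpow_neg_one, ENNReal.ofReal_inv_of_pos hn0, ENNReal.ofReal_natCast]

lemma count_upper {p d n : ℕ} (hd : 0 < d) (hn : 2 ≤ n) {Ω : Set (EuclideanSpace ℝ (Fin p))}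
    {r : ℝ} (hr : 0 < r) (x : Fin n → EuclideanSpace ℝ (Fin p)) (hmem : ∀ i, x i ∈ Ω)
    (hsep : ∀ i j, i ≠ j → r * (n : ℝ) ^ (-(1:ℝ)/d) ≤ dist (x i) (x j))
    (A : Set (EuclideanSpace ℝ (Fin p))) {δ : ℝ} (hδ : r * (n : ℝ) ^ (-(1:ℝ)/d) ≤ δ) :
    ENNReal.ofReal ((2 * (r / 3)) ^ d) * empiricalMeasure x A ≤ packingPremeasureAt d (A ∩ Ω) δ := by
  have hn0 : (0 : ℝ) < n := by positivity
  have hs : 0 < (n : ℝ) ^ (-(1:ℝ)/d) := by positivity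
  classical
  have key := le_packingAt d (A ∩ Ω) δ (ι := {i // x i ∈ A}) (fun i => x i.1)
    (fun _ => r / 3 * (n : ℝ) ^ (-(1:ℝ)/d)) ?_ ?_
  · refine le_trans (le_of_eq ?_) key
    simp only [← mul_assoc]
    rw [ofReal_scale_pow hd hn (by positivity), emp_apply, tsum_fintype, Finset.sum_const,
      nsmul_eq_mul, Finset.card_univ, ← Nat.card_eq_fintype_card]
    ring
  · refine fun i => ⟨⟨i.2, hmem _⟩, by positivity, ?_⟩
    have : 0 < r * (n : ℝ) ^ (-(1:ℝ)/d) := by positivity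
    linarith
  · intro i j hij
    apply closedBall_disjoint_closedBall
    have := hsep i j (fun h => hij (Subtype.ext h))
    have : 0 < r * (n : ℝ) ^ (-(1:ℝ)/d) := by positivity
    linarith

lemma scale_tendsto {d : ℕ} (hd : 0 < d) {φ : ℕ → ℕ} (hφ : StrictMono φ) (a : ℝ) :
    Tendsto (fun m => a * (φ m : ℝ) ^ (-(1:ℝ)/d)) atTop (𝓝 0) := by
  have h1 : Tendsto (fun m => (φ m : ℝ)) atTop atTop :=
    tendsto_natCast_atTop_atTop.comp hφ.tendsto_atTop
  have h2 := (tendsto_rpow_neg_atTop (y := (1:ℝ)/d) (by positivity)).comp h1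
  have := h2.const_mul a
  simpa [Function.comp_def, neg_div] using this

lemma lower_bound {p d : ℕ} (hd : 0 < d) {Ω K F : Set (EuclideanSpace ℝ (Fin p))} (hK : K ⊆ Ω)
    {R : ℝ} (hR : 0 < R) (x : (n : ℕ) → Fin n → EuclideanSpace ℝ (Fin p))
    (hcov : ∀ n : ℕ, 2 ≤ n → ∀ y ∈ Ω, ∃ i, dist y (x n i) ≤ R * (n : ℝ) ^ (-(1:ℝ)/d))
    {φ : ℕ → ℕ} (hφ : StrictMono φ) (hφ2 : ∀ m, 2 ≤ φ m) {ε : ℝ} (hε : 0 < ε)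
    (hF : ∀ y ∈ K, closedBall y ε ⊆ F) :
    μH[d] K ≤ ENNReal.ofReal ((2 * R) ^ d) *
      limsup (fun m => empiricalMeasure (x (φ m)) F) atTop := by
  classical
  refine (Measure.hausdorffMeasure_le_liminf_sum (d:ℝ) K (l := atTop)
    (ι := fun m => {i // x (φ m) i ∈ F})
    (fun m : ℕ => ENNReal.ofReal (2 * (R * (φ m : ℝ) ^ (-(1:ℝ)/d)))) ?_
    (fun m i => closedBall (x (φ m) i.1) (R * (φ m : ℝ) ^ (-(1:ℝ)/d))) ?_ ?_).trans ?_
  · rw [← ENNReal.ofReal_zero]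
    apply ENNReal.tendsto_ofReal
    simpa [mul_assoc] using scale_tendsto hd hφ (2 * R)
  · exact Eventually.of_forall fun m i => ediam_closedBall_le' _ _
  · filter_upwards [(scale_tendsto hd hφ R).eventually (Iic_mem_nhds hε)] with m hm y hy
    obtain ⟨i, hi⟩ := hcov (φ m) (hφ2 m) y (hK hy)
    refine mem_iUnion.2 ⟨⟨i, hF y hy ?_⟩, hi⟩
    rw [mem_closedBall, dist_comm]
    exact hi.trans hm
  · rw [← ENNReal.limsup_const_mul_of_ne_top ENNReal.ofReal_ne_top]
    refine le_trans liminf_le_limsup (limsup_le_limsup (Eventually.of_forall fun m => ?_))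
    refine (Finset.sum_le_sum fun i _ => ediam_closedBall_pow_le d _ _).trans (le_of_eq ?_)
    simp only [← mul_assoc]
    rw [ofReal_scale_pow hd (hφ2 m) (by positivity), emp_apply, Finset.sum_const,
      nsmul_eq_mul, Finset.card_univ, ← Nat.card_eq_fintype_card]
    ring

/-- Under the basis hypotheses on `Ω`, every weak-* limit point of the
empirical measures of admissible configurations is mutually absolutely continuous with
respect to `d`-dimensional Hausdorff measure on `Ω`. -/
theorem stmt_1 {p : ℕ} (d : ℕ) (hd : 0 < d) (hdp : d ≤ p)
    (Ω : Set (EuclideanSpace ℝ (Fin p))) (hΩcomp : IsCompact Ω) (hΩinf : Ω.Infinite)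
    (hΩpos : μH[d] Ω ≠ 0) (hΩfin : μH[d] Ω ≠ ⊤)
    (B : Set (Set Ω)) (hB : TopologicalSpace.IsTopologicalBasis B)
    (hBbd : ∀ U ∈ B,
      μH[d] (Subtype.val '' (frontier U) : Set (EuclideanSpace ℝ (Fin p))) = 0 ∧
      packingPremeasure d (Subtype.val '' (frontier U)) = 0)
    (hBeq : ∀ U ∈ B,
      packingPremeasure d (Subtype.val '' U) =
        μH[d] (Subtype.val '' U : Set (EuclideanSpace ℝ (Fin p))))
    (r R : ℝ) (hr : 0 < r) (hR : 0 < R)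
    (x : (n : ℕ) → Fin n → EuclideanSpace ℝ (Fin p))
    (hmem : ∀ n : ℕ, 2 ≤ n → ∀ i, x n i ∈ Ω)
    (hsep : ∀ n : ℕ, 2 ≤ n → ∀ i j, i ≠ j → r * (n : ℝ) ^ (-(1:ℝ)/d) ≤ dist (x n i) (x n j))
    (hcov : ∀ n : ℕ, 2 ≤ n → ∀ y ∈ Ω, ∃ i, dist y (x n i) ≤ R * (n : ℝ) ^ (-(1:ℝ)/d))
    (ν : Measure (EuclideanSpace ℝ (Fin p)))
    (hν : ∃ φ : ℕ → ℕ, StrictMono φ ∧ (∀ m, 2 ≤ φ m) ∧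
      ∀ g : BoundedContinuousFunction (EuclideanSpace ℝ (Fin p)) ℝ,
        Filter.Tendsto (fun m => ∫ a, g a ∂(empiricalMeasure (x (φ m)))) Filter.atTop
          (nhds (∫ a, g a ∂ν))) :
    ν ≪ (μH[d]).restrict Ω ∧ (μH[d]).restrict Ω ≪ ν := by
  classical
  obtain ⟨φ, hφ, hφ2, hlim⟩ := hν
  have hemp1 : ∀ m, IsProbabilityMeasure (empiricalMeasure (x (φ m))) := by
    intro m
    constructor
    have h2 := hφ2 m
    rw [emp_apply]
    simp only [mem_univ, Nat.card_eq_fintype_card, Fintype.card_subtype_true, Fintype.card_fin]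
    exact ENNReal.inv_mul_cancel (by positivity) (by simp)
  have hνprob : IsProbabilityMeasure ν := by
    have h1 := hlim (BoundedContinuousFunction.const _ 1)
    simp only [BoundedContinuousFunction.const_apply, integral_const, smul_eq_mul, mul_one,
      probReal_univ] at h1
    have h2 : ν.real univ = 1 := tendsto_nhds_unique h1 tendsto_const_nhds
    constructor
    rw [measureReal_def] at h2
    exact (ENNReal.toReal_eq_one_iff _).1 h2
  let μs : ℕ → ProbabilityMeasure (EuclideanSpace ℝ (Fin p)) :=
    fun m => ⟨empiricalMeasure (x (φ m)), hemp1 m⟩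
  let μl : ProbabilityMeasure (EuclideanSpace ℝ (Fin p)) := ⟨ν, hνprob⟩
  have hT : Tendsto μs atTop (𝓝 μl) :=
    ProbabilityMeasure.tendsto_iff_forall_integral_tendsto.2 hlim
  have hopen : ∀ G : Set (EuclideanSpace ℝ (Fin p)), IsOpen G →
      ν G ≤ liminf (fun m => empiricalMeasure (x (φ m)) G) atTop := fun G hG =>
    ProbabilityMeasure.le_liminf_measure_open_of_tendsto hT hG
  have hclosed : ∀ F : Set (EuclideanSpace ℝ (Fin p)), IsClosed F →
      limsup (fun m => empiricalMeasure (x (φ m)) F) atTop ≤ ν F := fun F hF =>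
    ProbabilityMeasure.limsup_measure_closed_le_of_tendsto hT hF
  have hfinR : IsFiniteMeasure ((μH[d] : Measure (EuclideanSpace ℝ (Fin p))).restrict Ω) :=
    ⟨by simpa [lt_top_iff_ne_top] using hΩfin⟩
  have hΩm : MeasurableSet Ω := hΩcomp.measurableSet
  have hΩc : ν Ωᶜ = 0 := by
    refine le_antisymm ((hopen _ hΩcomp.isClosed.isOpen_compl).trans (le_of_eq ?_)) zero_le
    have : ∀ m, empiricalMeasure (x (φ m)) Ωᶜ = 0 := by
      intro m
      rw [emp_apply]
      have : IsEmpty {i // x (φ m) i ∈ Ωᶜ} := ⟨fun i => i.2 (hmem _ (hφ2 m) _)⟩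
      rw [Nat.card_of_isEmpty]
      simp
    simp [this]
  constructor
  · set c := ENNReal.ofReal ((2 * (r / 3)) ^ d) with hc
    have hc0 : c ≠ 0 := by
      rw [hc, Ne, ENNReal.ofReal_eq_zero, not_le]
      positivity
    have hctop : c ≠ ⊤ := ENNReal.ofReal_ne_top
    have key0 : ∀ O A : Set (EuclideanSpace ℝ (Fin p)), IsOpen O → O ⊆ A →
        c * ν O ≤ packingPremeasure d (A ∩ Ω) := by
      intro O A hO hOA
      refine le_iInf₂ fun δ hδ => ?_
      have h1 : ∀ᶠ m in atTop, c * empiricalMeasure (x (φ m)) O ≤ packingPremeasureAt d (A ∩ Ω) δ := by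
        filter_upwards [(scale_tendsto hd hφ r).eventually (Iic_mem_nhds hδ)] with m hm
        exact (mul_le_mul_right (measure_mono hOA) c).trans
          (count_upper hd (hφ2 m) hr _ (hmem _ (hφ2 m)) (hsep _ (hφ2 m)) A hm)
      calc c * ν O ≤ c * liminf (fun m => empiricalMeasure (x (φ m)) O) atTop := by
            gcongr
            exact hopen O hO
        _ ≤ c * (packingPremeasureAt d (A ∩ Ω) δ / c) := by
            gcongr
            refine liminf_le_of_le (by isBoundedDefault) fun b hb => ?_
            obtain ⟨m, hm1, hm2⟩ := (hb.and h1).exists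
            refine hm1.trans ?_
            rw [ENNReal.le_div_iff_mul_le (Or.inl hc0) (Or.inl hctop), mul_comm]
            exact hm2
        _ ≤ _ := ENNReal.mul_div_le
    have key1 : ∀ V ∈ B, ∀ O : Set (EuclideanSpace ℝ (Fin p)), IsOpen O →
        O ∩ Ω ⊆ Subtype.val '' V → c * ν O ≤ μH[d] (O ∩ Ω) := by
      intro V hV O hO hOV
      rw [hO.measure_eq_iSup_isCompact, ENNReal.mul_iSup]
      refine iSup_le fun K => ?_
      rw [ENNReal.mul_iSup]
      refine iSup_le fun hKO => ?_
      rw [ENNReal.mul_iSup]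
      refine iSup_le fun hK => ?_
      obtain ⟨K', hK', hKK', hK'O⟩ := exists_compact_between hK hO hKO
      have h1 : c * ν K ≤ packingPremeasure d (K' ∩ Ω) :=
        (mul_le_mul_right (measure_mono hKK') c).trans
          (key0 (interior K') K' isOpen_interior interior_subset)
      refine h1.trans ?_
      obtain ⟨η, hη, hsepK⟩ := Metric.exists_pos_forall_lt_edist hK' hO.isClosed_compl
        (disjoint_compl_right_iff_subset.2 hK'O)
      have hV' : (Subtype.val '' V : Set (EuclideanSpace ℝ (Fin p))) ⊆ Ω := by
        rintro _ ⟨y, _, rfl⟩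
        exact y.2
      have h2 : packingPremeasure d (K' ∩ Ω) + packingPremeasure d (Subtype.val '' V \ O) ≤
          packingPremeasure d (Subtype.val '' V) := by
        refine packing_superadd d ?_ sdiff_subset (ε := η) hη ?_
        · exact (inter_subset_inter_left _ hK'O).trans hOV
        · intro a ha b hb
          have := (hsepK a ha.1 b hb.2).le
          rw [edist_nndist] at this
          exact_mod_cast this
      rw [hBeq V hV] at h2
      have h3 : μH[d] (Subtype.val '' V : Set (EuclideanSpace ℝ (Fin p))) ≤
          μH[d] (O ∩ Ω) + μH[d] (Subtype.val '' V \ O) := by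
        refine (measure_mono ?_).trans (measure_union_le _ _)
        intro y hy
        by_cases hyO : y ∈ O
        · exact Or.inl ⟨hyO, hV' hy⟩
        · exact Or.inr ⟨hy, hyO⟩
      have h4 : μH[d] (Subtype.val '' V \ O) ≠ ⊤ :=
        ne_top_of_le_ne_top hΩfin (measure_mono (sdiff_subset.trans hV'))
      have h5 := (add_le_add_right (hausdorff_le_packing d (Subtype.val '' V \ O))
        (packingPremeasure d (K' ∩ Ω))).trans (h2.trans h3)
      exact (ENNReal.add_le_add_iff_right h4).1 h5
    refine Measure.AbsolutelyContinuous.mk fun s hs hs0 => ?_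
    have key2 : ∀ V ∈ B, ν (s ∩ Subtype.val '' V) = 0 := by
      intro V hV
      obtain ⟨O0, hO0, hVO⟩ := isOpen_induced_iff.1 (hB.isOpen hV)
      have h1 : c * ν (s ∩ Subtype.val '' V) = 0 := by
        refine le_antisymm (le_of_forall_gt fun ε hε => ?_) zero_le
        obtain ⟨O1, hsO1, hO1, hlt⟩ := s.exists_isOpen_lt_of_lt _ (hs0.trans_lt hε)
        rw [Measure.restrict_apply hO1.measurableSet] at hlt
        refine lt_of_le_of_lt ?_ hlt
        refine le_trans ?_ ((key1 V hV (O0 ∩ O1) (hO0.inter hO1) ?_).trans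
          (measure_mono (inter_subset_inter_left _ inter_subset_right)))
        · refine mul_le_mul_right (measure_mono ?_) c
          rintro _ ⟨hys, y, hy, rfl⟩
          rw [← hVO] at hy
          exact ⟨hy, hsO1 hys⟩
        · rintro y ⟨⟨hy0, _⟩, hyΩ⟩
          refine ⟨⟨y, hyΩ⟩, ?_, rfl⟩
          rw [← hVO]
          exact hy0
      exact (mul_eq_zero.1 h1).resolve_left hc0
    obtain ⟨T, hTc, hTB, hTeq⟩ := TopologicalSpace.isOpen_sUnion_countable B (fun V hV => hB.isOpen hV)
    have h1 : ν (⋃ V ∈ T, s ∩ Subtype.val '' V) = 0 :=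
      (measure_biUnion_null_iff hTc).2 (fun V hV => key2 V (hTB hV))
    refine measure_mono_null ?_ (measure_union_null hΩc h1)
    intro y hy
    by_cases hyΩ : y ∈ Ω
    · right
      have h2 : (⟨y, hyΩ⟩ : Ω) ∈ ⋃₀ T := by
        rw [hTeq, hB.sUnion_eq]
        trivial
      obtain ⟨V, hV, hyV⟩ := h2
      exact mem_biUnion hV ⟨hy, ⟨y, hyΩ⟩, hyV, rfl⟩
    · exact Or.inl hyΩ
  · refine Measure.AbsolutelyContinuous.mk fun s hs hs0 => ?_
    rw [Measure.restrict_apply hs]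
    by_contra hne
    have hpos : 0 < (μH[d] : Measure (EuclideanSpace ℝ (Fin p))).restrict Ω (s ∩ Ω) := by
      rw [Measure.restrict_apply (hs.inter hΩm), inter_assoc, inter_self]
      exact pos_iff_ne_zero.2 hne
    obtain ⟨K, hKs, hK, hKpos⟩ := (hs.inter hΩm).exists_lt_isCompact hpos
    have hKΩ : K ⊆ Ω := hKs.trans inter_subset_right
    rw [Measure.restrict_apply hK.measurableSet, inter_eq_left.2 hKΩ] at hKpos
    have hνK : ν K = 0 := measure_mono_null (hKs.trans inter_subset_left) hs0
    set C := ENNReal.ofReal ((2 * R) ^ d) with hC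
    have hC0 : C ≠ 0 := by
      rw [hC, Ne, ENNReal.ofReal_eq_zero, not_le]
      positivity
    have hCtop : C ≠ ⊤ := ENNReal.ofReal_ne_top
    obtain ⟨U, hKU, hU, hlt⟩ := K.exists_isOpen_lt_of_lt (μ := ν) (μH[d] K / C)
      (hνK.trans_lt (ENNReal.div_pos hKpos.ne' hCtop))
    obtain ⟨ε, hε, hεU⟩ := hK.exists_cthickening_subset_open hU hKU
    have h1 := lower_bound (F := cthickening ε K) hd hKΩ hR x hcov hφ hφ2 hε
      (fun y hy => closedBall_subset_cthickening hy ε)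
    have h2 : μH[d] K ≤ C * ν U := h1.trans (by
      gcongr
      exact (hclosed _ isClosed_cthickening).trans (measure_mono hεU))
    rw [ENNReal.lt_div_iff_mul_lt (Or.inl hC0) (Or.inl hCtop), mul_comm] at hlt
    exact absurd h2 (not_le.2 hlt)

end
end

section
/- Let Ω = closed ball of radius R₀ > 0 centered at 0 in ℝ^d (with Lebesgue measure), let k(x,y) = f(|x−y|) where f: (0,∞) → [0,∞) is decreasing and k is absolutely integrable, and let ρ_+ ≥ |Ω|_d^{−1} ≥ ρ_− > 0. Let r' ∈ [0, R₀] be such that ρ_+ β_d (r')^d + ρ_− (β_d R₀^d − β_d (r')^d) = 1, where β_d is the volume of the unit ball in ℝ^d, and define ρ*(x) := ρ_+ for |x| ≤ r' and ρ*(x) := ρ_− for r' < |x| ≤ R₀. Then ρ* ∈ A(Ω, ρ_+, ρ_−) and E[ρ*] ≥ E[ρ] for every ρ ∈ A(Ω, ρ_+, ρ_−). -/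
noncomputable section

open MeasureTheory Metric Set Filter
open scoped ENNReal NNReal Topology

/-- The energy `E[ρ] = (1/2) ∫_{Ω×Ω} k(x,y) ρ(x) ρ(y) dx dy`. -/
def energy {α : Type} [MeasurableSpace α] (μ : Measure α) (Ω : Set α)
    (k : α → α → ℝ) (ρ : α → ℝ) : ℝ :=
  (1/2 : ℝ) * ∫ x in Ω, (∫ y in Ω, k x y * ρ x * ρ y ∂μ) ∂μ

/-- The admissible class `A(Ω, ρ₊, ρ₋)`. -/
def IsAdmissible {α : Type} [MeasurableSpace α] (μ : Measure α) (Ω : Set α)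
    (ρp ρm : ℝ) (ρ : α → ℝ) : Prop :=
  AEStronglyMeasurable ρ (μ.restrict Ω) ∧ (∫ x in Ω, ρ x ∂μ) = 1 ∧
  ∀ᵐ x ∂(μ.restrict Ω), ρm ≤ ρ x ∧ ρ x ≤ ρp

/-- `β_d = π^{d/2} / Γ(d/2 + 1)`, the volume of the unit ball in `ℝ^d`. -/
def ballVol (d : ℕ) : ℝ := Real.pi ^ ((d : ℝ)/2) / Real.Gamma ((d : ℝ)/2 + 1)

theorem exists_refl {d : ℕ} (a b : EuclideanSpace ℝ (Fin d)) (hab : ‖a‖ < ‖b‖) :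
    ∃ (σ : EuclideanSpace ℝ (Fin d) → EuclideanSpace ℝ (Fin d)) (h : EuclideanSpace ℝ (Fin d) → ℝ)
      (κ : ℝ), 0 < κ ∧ MeasurePreserving σ volume volume ∧ Continuous σ ∧ Continuous h ∧
      (∀ x, σ (σ x) = x) ∧ (∀ x, h (σ x) = - h x) ∧
      (∀ x y, dist x (σ y) ^ 2 = dist x y ^ 2 + κ * (h x * h y)) ∧
      σ a = b ∧ 0 < h a ∧ 0 < h 0 := by
  have hne : b - a ≠ 0 := by
    intro h
    rw [sub_eq_zero.1 h] at hab
    exact lt_irrefl _ hab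
  obtain ⟨n, hn⟩ : ∃ n, n = b - a := ⟨_, rfl⟩
  obtain ⟨p, hp⟩ : ∃ p, p = (1/2 : ℝ) • (a + b) := ⟨_, rfl⟩
  rw [← hn] at hne
  have hn0 : 0 < ‖n‖ := norm_pos_iff.2 hne
  let h : EuclideanSpace ℝ (Fin d) → ℝ := fun x => inner ℝ (p - x) n
  let σ : EuclideanSpace ℝ (Fin d) → EuclideanSpace ℝ (Fin d) := fun x => x + (2 * h x / ‖n‖^2) • n
  have hh : ∀ x, h x = inner ℝ (p - x) n := fun x => rfl
  have hσ : ∀ x, σ x = x + (2 * h x / ‖n‖^2) • n := fun x => rfl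
  have h1 : ∀ x, h (σ x) = - h x := by
    intro x
    rw [hh (σ x), hσ, ← sub_sub, inner_sub_left, ← hh, inner_smul_left, real_inner_self_eq_norm_sq]
    simp
    field_simp
    ring
  have h2 : ∀ x y, dist x (σ y) ^ 2 = dist x y ^ 2 + (4 / ‖n‖^2) * (h x * h y) := by
    intro x y
    rw [dist_eq_norm, dist_eq_norm, hσ, ← sub_sub, norm_sub_sq_real, inner_smul_right, norm_smul]
    have : inner ℝ (x - y) n = h y - h x := by
      rw [hh, hh, ← inner_sub_left]; congr 1; abel
    rw [this, mul_pow, Real.norm_eq_abs, sq_abs]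
    field_simp
    ring
  have hc : Continuous h := by fun_prop
  have hinv : ∀ x, σ (σ x) = x := by
    intro x
    have e := h2 x (σ x)
    rw [h2 x x, h1] at e
    have : dist x (σ (σ x)) ^ 2 = 0 := by rw [e]; simp
    exact (dist_eq_zero.1 (pow_eq_zero_iff (two_ne_zero) |>.1 this)).symm
  have hha : h a = ‖n‖^2/2 := by
    rw [hh, ← real_inner_self_eq_norm_sq]
    have : p - a = (1/2 : ℝ) • n := by rw [hp, hn]; module
    rw [this, inner_smul_left]; simp; ring
  have hL : σ = fun x => ((ℝ ∙ n)ᗮ.reflection x) + (2 * h 0 / ‖n‖^2) • n := by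
    funext x
    rw [hσ, Submodule.reflection_orthogonal_apply, Submodule.reflection_singleton_apply]
    have : h x = h 0 - inner ℝ n x := by
      rw [hh, hh, inner_sub_left, inner_sub_left, real_inner_comm x n]; simp
    rw [this]
    simp only [RCLike.ofReal_real_eq_id, id]
    module
  refine ⟨σ, h, 4 / ‖n‖^2, by positivity, ?_, by fun_prop, hc, hinv, h1, h2, ?_, ?_, ?_⟩
  · rw [hL]
    exact (measurePreserving_add_right volume _).comp
      ((ℝ ∙ n)ᗮ.reflection.measurePreserving)
  · rw [hσ, hha]
    have : 2 * (‖n‖^2/2) / ‖n‖^2 = 1 := by field_simp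
    rw [this, hn]; simp
  · rw [hha]; positivity
  · have : h 0 = (‖b‖^2 - ‖a‖^2)/2 := by
      rw [hh, hp, hn, sub_zero, inner_smul_left, ← real_inner_self_eq_norm_sq, ← real_inner_self_eq_norm_sq,
        inner_add_left, inner_sub_right, inner_sub_right, real_inner_comm a b]
      simp
      ring
    rw [this]
    nlinarith [norm_nonneg a]

theorem wc_prod_bound {α : Type} [MeasurableSpace α] {μ : Measure α} [IsFiniteMeasure μ]
    {m M : ℝ} (hm : 0 ≤ m) {w : α → ℝ} (hb : ∀ᵐ x ∂μ, m ≤ w x ∧ w x ≤ M) :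
    ∀ᵐ z ∂(μ.prod μ), ‖w z.1 * w z.2‖ ≤ M ^ 2 := by
  have h1 : ∀ᵐ z ∂(μ.prod μ), m ≤ w z.1 ∧ w z.1 ≤ M := Measure.quasiMeasurePreserving_fst.ae hb
  have h2 : ∀ᵐ z ∂(μ.prod μ), m ≤ w z.2 ∧ w z.2 ≤ M := Measure.quasiMeasurePreserving_snd.ae hb
  filter_upwards [h1, h2] with z ⟨a1, a2⟩ ⟨b1, b2⟩
  rw [Real.norm_eq_abs, abs_of_nonneg (mul_nonneg (hm.trans a1) (hm.trans b1)), pow_two]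
  exact mul_le_mul a2 b2 (hm.trans b1) ((hm.trans a1).trans a2)

theorem wc_integrable {α : Type} [MeasurableSpace α] {μ : Measure α} [IsFiniteMeasure μ]
    {m M : ℝ} (hm : 0 ≤ m) {w : α → ℝ} (hw : AEStronglyMeasurable w μ)
    (hb : ∀ᵐ x ∂μ, m ≤ w x ∧ w x ≤ M) {k : α × α → ℝ} (hk : Integrable k (μ.prod μ)) :
    Integrable (fun z => k z * (w z.1 * w z.2)) (μ.prod μ) := by
  refine Integrable.mul_bdd (c := M ^ 2) hk ?_ (wc_prod_bound hm hb)
  exact (hw.comp_quasiMeasurePreserving Measure.quasiMeasurePreserving_fst).mul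
    (hw.comp_quasiMeasurePreserving Measure.quasiMeasurePreserving_snd)

theorem wc_diff {α : Type} [MeasurableSpace α] {μ : Measure α} [IsFiniteMeasure μ]
    {m M : ℝ} (hm : 0 ≤ m) {w : α → ℝ} (hw : AEStronglyMeasurable w μ)
    (hb : ∀ᵐ x ∂μ, m ≤ w x ∧ w x ≤ M) {k k' : α × α → ℝ} (hk : Integrable k (μ.prod μ))
    (hk' : Integrable k' (μ.prod μ)) :
    dist (∫ z, k z * (w z.1 * w z.2) ∂(μ.prod μ)) (∫ z, k' z * (w z.1 * w z.2) ∂(μ.prod μ))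
      ≤ M ^ 2 * ∫ z, ‖k z - k' z‖ ∂(μ.prod μ) := by
  rw [dist_eq_norm, ← integral_sub (wc_integrable hm hw hb hk) (wc_integrable hm hw hb hk'),
    ← integral_const_mul]
  refine (norm_integral_le_integral_norm _).trans ?_
  refine integral_mono_ae ?_ ?_ ?_
  · exact ((wc_integrable hm hw hb hk).sub (wc_integrable hm hw hb hk')).norm
  · exact (hk.sub hk').norm.const_mul _
  · filter_upwards [wc_prod_bound hm hb] with z hz
    rw [← sub_mul, norm_mul, mul_comm]
    gcongr

/-- uniform limits: if the kernels converge in `L¹`, continuity passes to the limit. -/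
theorem wc_lim {α X : Type} [TopologicalSpace X] [MeasurableSpace α] {μ : Measure α}
    [IsFiniteMeasure μ]
    {m M : ℝ} (hm : 0 ≤ m) {K : Set X} {w : X → α → ℝ}
    (hw : ∀ l ∈ K, AEStronglyMeasurable (w l) μ)
    (hb : ∀ l ∈ K, ∀ᵐ x ∂μ, m ≤ w l x ∧ w l x ≤ M) {k : α × α → ℝ} {k' : ℕ → α × α → ℝ}
    (hk : Integrable k (μ.prod μ))
    (hk' : ∀ n, Integrable (k' n) (μ.prod μ))
    (hc : ∀ n, ContinuousOn (fun l => ∫ z, k' n z * (w l z.1 * w l z.2) ∂(μ.prod μ)) K)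
    (hl : Tendsto (fun n => ∫ z, ‖k z - k' n z‖ ∂(μ.prod μ)) atTop (𝓝 0)) :
    ContinuousOn (fun l => ∫ z, k z * (w l z.1 * w l z.2) ∂(μ.prod μ)) K := by
  have : TendstoUniformlyOn (fun n l => ∫ z, k' n z * (w l z.1 * w l z.2) ∂(μ.prod μ))
      (fun l => ∫ z, k z * (w l z.1 * w l z.2) ∂(μ.prod μ)) atTop K := by
    rw [Metric.tendstoUniformlyOn_iff]
    intro ε hε
    have h2 : Tendsto (fun n => M ^ 2 * ∫ z, ‖k z - k' n z‖ ∂(μ.prod μ)) atTop (𝓝 0) := by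
      simpa using hl.const_mul (M ^ 2)
    filter_upwards [h2.eventually (gt_mem_nhds hε)] with n hn l hlK
    exact (wc_diff hm (hw l hlK) (hb l hlK) hk (hk' n)).trans_lt hn
  exact this.continuousOn (Frequently.of_forall hc)

theorem wc_cont {α X : Type} [TopologicalSpace X] [MeasurableSpace α] {μ : Measure α}
    [IsFiniteMeasure μ]
    {m M : ℝ} (hm : 0 ≤ m) {K : Set X} {w : X → α → ℝ}
    (hw : ∀ l ∈ K, AEStronglyMeasurable (w l) μ)
    (hb : ∀ l ∈ K, ∀ᵐ x ∂μ, m ≤ w l x ∧ w l x ≤ M)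
    (hs : ∀ s, MeasurableSet s → ContinuousOn (fun l => ∫ x in s, w l x ∂μ) K)
    {k : α × α → ℝ} (hk : Integrable k (μ.prod μ)) :
    ContinuousOn (fun l => ∫ z, k z * (w l z.1 * w l z.2) ∂(μ.prod μ)) K := by
  have hind : ∀ S : Set (α × α), MeasurableSet S →
      Integrable (S.indicator (fun _ => (1:ℝ))) (μ.prod μ) := fun S hS =>
    (integrable_const (1:ℝ)).indicator hS
  have hrect : ∀ s t : Set α, MeasurableSet s → MeasurableSet t →
      ContinuousOn (fun l => ∫ z, (s ×ˢ t).indicator (fun _ => (1:ℝ)) z * (w l z.1 * w l z.2)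
        ∂(μ.prod μ)) K := by
    intro s t hs' ht'
    have : (fun l => ∫ z, (s ×ˢ t).indicator (fun _ => (1:ℝ)) z * (w l z.1 * w l z.2)
        ∂(μ.prod μ)) = fun l => (∫ x in s, w l x ∂μ) * (∫ x in t, w l x ∂μ) := by
      funext l
      rw [← setIntegral_prod_mul, ← integral_indicator (hs'.prod ht')]
      congr 1
      funext z
      by_cases hz : z ∈ s ×ˢ t <;> simp only [indicator, hz] <;> simp
    rw [this]
    exact (hs s hs').mul (hs t ht')
  have hset : ∀ S : Set (α × α), MeasurableSet S →
      ContinuousOn (fun l => ∫ z, S.indicator (fun _ => (1:ℝ)) z * (w l z.1 * w l z.2)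
        ∂(μ.prod μ)) K := by
    intro S hS
    induction S, hS using MeasurableSpace.induction_on_inter generateFrom_prod.symm
      isPiSystem_prod with
    | empty => simpa using continuousOn_const
    | basic t ht =>
      obtain ⟨s, hs', t, ht', rfl⟩ := ht
      exact hrect s t hs' ht'
    | compl t htm ih =>
      have h1 := (hrect univ univ MeasurableSet.univ MeasurableSet.univ).sub ih
      refine h1.congr ?_
      intro l hl
      simp only [Pi.sub_apply]
      rw [← integral_sub]
      · congr 1
        funext z
        by_cases hz : z ∈ t <;> simp [indicator, hz]
      · exact wc_integrable hm (hw l hl) (hb l hl) (hind _ (MeasurableSet.univ.prod MeasurableSet.univ))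
      · exact wc_integrable hm (hw l hl) (hb l hl) (hind _ htm)
    | iUnion f hd hfm ih =>
      refine wc_lim hm hw hb (k' := fun n z => ∑ i ∈ Finset.range n,
        (f i).indicator (fun _ => (1:ℝ)) z) (hind _ (MeasurableSet.iUnion hfm)) ?_ ?_ ?_
      · intro n
        exact integrable_finsetSum _ (fun i _ => hind _ (hfm i))
      · intro n
        have h1 : ContinuousOn (fun l => ∑ i ∈ Finset.range n,
          ∫ z, (f i).indicator (fun _ => (1:ℝ)) z * (w l z.1 * w l z.2) ∂(μ.prod μ)) K :=
            continuousOn_finsetSum _ (fun i _ => ih i)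
        refine h1.congr ?_
        intro l hl
        simp only
        rw [← integral_finsetSum]
        · simp only [Finset.sum_mul]
        · exact fun i _ => wc_integrable hm (hw l hl) (hb l hl) (hind _ (hfm i))
      · have hpt : ∀ z, HasSum (fun i => (f i).indicator (fun _ => (1:ℝ)) z)
            ((⋃ i, f i).indicator (fun _ => (1:ℝ)) z) := by
          intro z
          by_cases hz : ∃ i, z ∈ f i
          · obtain ⟨i, hi⟩ := hz
            have e : (⋃ i, f i).indicator (fun _ => (1:ℝ)) z =
                (f i).indicator (fun _ => (1:ℝ)) z := by
              rw [indicator_of_mem hi, indicator_of_mem (mem_iUnion.2 ⟨i, hi⟩)]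
            rw [e]
            refine hasSum_single i fun j hj => ?_
            exact indicator_of_notMem (fun hzj => (Set.disjoint_left.1 (hd hj) hzj) hi) _
          · have e : (⋃ i, f i).indicator (fun _ => (1:ℝ)) z = 0 :=
              indicator_of_notMem (fun h => hz (mem_iUnion.1 h)) _
            rw [e]
            have e2 : (fun i => (f i).indicator (fun _ => (1:ℝ)) z) = fun _ => 0 := by
              funext i
              exact indicator_of_notMem (fun h => hz ⟨i, h⟩) _
            rw [e2]
            exact hasSum_zero
        have hle : ∀ n z, 0 ≤ ∑ i ∈ Finset.range n, (f i).indicator (fun _ => (1:ℝ)) z ∧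
            ∑ i ∈ Finset.range n, (f i).indicator (fun _ => (1:ℝ)) z ≤
            (⋃ i, f i).indicator (fun _ => (1:ℝ)) z := by
          intro n z
          have h0 : ∀ i, 0 ≤ (f i).indicator (fun _ => (1:ℝ)) z := fun i =>
            indicator_nonneg (fun _ _ => zero_le_one) z
          exact ⟨Finset.sum_nonneg fun i _ => h0 i, sum_le_hasSum _ (fun i _ => h0 i) (hpt z)⟩
        have := tendsto_integral_of_dominated_convergence (μ := μ.prod μ)
          (F := fun n z => ‖(⋃ i, f i).indicator (fun _ => (1:ℝ)) z -
            ∑ i ∈ Finset.range n, (f i).indicator (fun _ => (1:ℝ)) z‖) (f := fun _ => 0)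
          (fun _ => 1) ?_ (integrable_const _) ?_ ?_
        · simpa using this
        · intro n
          exact ((hind _ (MeasurableSet.iUnion hfm)).sub
            (integrable_finsetSum _ (fun i _ => hind _ (hfm i)))).norm.aestronglyMeasurable
        · intro n
          refine Eventually.of_forall fun z => ?_
          have h1 := hle n z
          have h2 : (⋃ i, f i).indicator (fun _ => (1:ℝ)) z ≤ 1 :=
            indicator_le_self' (fun _ _ => zero_le_one) z
          rw [norm_norm, Real.norm_eq_abs, abs_le]
          constructor <;> linarith [h1.1, h1.2]
        · refine Eventually.of_forall fun z => ?_
          have := (hpt z).tendsto_sum_nat.const_sub ((⋃ i, f i).indicator (fun _ => (1:ℝ)) z)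
          simpa using this.norm
  refine Integrable.induction (P := fun k => ContinuousOn
    (fun l => ∫ z, k z * (w l z.1 * w l z.2) ∂(μ.prod μ)) K) ?_ ?_ ?_ ?_ hk
  · intro c s hs' _
    refine ((hset s hs').const_smul c).congr ?_
    intro l hl
    simp only [Pi.smul_apply, smul_eq_mul]
    rw [← integral_const_mul]
    congr 1
    funext z
    by_cases hz : z ∈ s <;> simp [indicator, hz]
  · intro f g _ hf hg h1 h2
    refine (h1.add h2).congr ?_
    intro l hl
    simp only [Pi.add_apply]
    rw [← integral_add (wc_integrable hm (hw l hl) (hb l hl) hf)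
      (wc_integrable hm (hw l hl) (hb l hl) hg)]
    congr 1
    funext z
    ring
  · refine isClosed_of_closure_subset ?_
    intro f hf
    obtain ⟨x, hx, hlim⟩ := mem_closure_iff_seq_limit.1 hf
    refine wc_lim hm hw hb (k' := fun n => x n) (L1.integrable_coeFn f)
      (fun n => L1.integrable_coeFn (x n)) hx ?_
    have h1 := (tendsto_iff_dist_tendsto_zero.1 hlim)
    refine h1.congr ?_
    intro n
    rw [dist_comm, dist_eq_norm, L1.norm_eq_integral_norm]
    refine integral_congr_ae ?_
    filter_upwards [Lp.coeFn_sub f (x n)] with z hz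
    rw [hz]; rfl
  · intro f g hfg hf h1
    refine h1.congr ?_
    intro l hl
    refine integral_congr_ae ?_
    filter_upwards [hfg] with z hz
    rw [hz]

theorem exists_max {α : Type} [MeasurableSpace α] {μ : Measure α} [IsFiniteMeasure μ]
    {m M : ℝ} (hm : 0 ≤ m) {k : α × α → ℝ} (hk : Integrable k (μ.prod μ))
    {w₀ : α → ℝ} (hw₀ : AEStronglyMeasurable w₀ μ) (hw₀1 : ∫ x, w₀ x ∂μ = 1)
    (hw₀b : ∀ᵐ x ∂μ, m ≤ w₀ x ∧ w₀ x ≤ M) :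
    ∃ w : α → ℝ, AEStronglyMeasurable w μ ∧ ∫ x, w x ∂μ = 1 ∧ (∀ᵐ x ∂μ, m ≤ w x ∧ w x ≤ M) ∧
      ∀ v : α → ℝ, AEStronglyMeasurable v μ → ∫ x, v x ∂μ = 1 → (∀ᵐ x ∂μ, m ≤ v x ∧ v x ≤ M) →
        ∫ z, k z * (v z.1 * v z.2) ∂(μ.prod μ) ≤ ∫ z, k z * (w z.1 * w z.2) ∂(μ.prod μ) := by
  let T : WeakDual ℝ (Lp ℝ 2 μ) → Lp ℝ 2 μ := fun l =>
    (InnerProductSpace.toDual ℝ (Lp ℝ 2 μ)).symm (WeakDual.toStrongDual l)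
  let I : ∀ s : Set α, MeasurableSet s → Lp ℝ 2 μ := fun s hs =>
    indicatorConstLp 2 hs (measure_ne_top μ s) 1
  have hT : ∀ l s (hs : MeasurableSet s), l (I s hs) = ∫ x in s, T l x ∂μ := by
    intro l s hs
    rw [← L2.inner_indicatorConstLp_one hs (measure_ne_top μ s) (T l), real_inner_comm,
      InnerProductSpace.toDual_symm_apply]
    rfl
  have hTi : ∀ l, Integrable (T l) μ := fun l => (Lp.memLp (T l)).integrable (by norm_num)
  have hev : ∀ y : Lp ℝ 2 μ, Continuous (fun l : WeakDual ℝ (Lp ℝ 2 μ) => l y) :=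
    fun y => WeakDual.eval_continuous y
  let K : Set (WeakDual ℝ (Lp ℝ 2 μ)) := {l | l (I univ MeasurableSet.univ) = 1 ∧
    ∀ s (hs : MeasurableSet s), m * μ.real s ≤ l (I s hs) ∧ l (I s hs) ≤ M * μ.real s}
  have hKclosed : IsClosed K := by
    have : K = {l | l (I univ MeasurableSet.univ) = 1} ∩ ⋂ s, ⋂ hs : MeasurableSet s,
        ({l | m * μ.real s ≤ l (I s hs)} ∩ {l | l (I s hs) ≤ M * μ.real s}) := by
      ext l; simp [K]
    rw [this]
    refine (isClosed_eq (hev _) continuous_const).inter ?_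
    refine isClosed_iInter fun s => isClosed_iInter fun hs => ?_
    exact (isClosed_le continuous_const (hev _)).inter (isClosed_le (hev _) continuous_const)
  have hKb : ∀ l ∈ K, ∀ᵐ x ∂μ, m ≤ T l x ∧ T l x ≤ M := by
    intro l hl
    have h1 : (fun _ => m) ≤ᵐ[μ] T l := by
      refine ae_le_of_forall_setIntegral_le (integrable_const m) (hTi l) fun s hs _ => ?_
      rw [← hT l s hs, setIntegral_const, smul_eq_mul, mul_comm]
      exact (hl.2 s hs).1
    have h2 : T l ≤ᵐ[μ] (fun _ => M) := by
      refine ae_le_of_forall_setIntegral_le (hTi l) (integrable_const M) fun s hs _ => ?_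
      rw [← hT l s hs, setIntegral_const, smul_eq_mul, mul_comm]
      exact (hl.2 s hs).2
    filter_upwards [h1, h2] with x a b using ⟨a, b⟩
  have hMm : ∀ x, m ≤ x ∧ x ≤ M → ‖x‖ ≤ |M| := by
    intro x ⟨h1, h2⟩
    rw [Real.norm_eq_abs, abs_of_nonneg (hm.trans h1)]
    exact h2.trans (le_abs_self M)
  obtain ⟨C, hC⟩ : ∃ C : ℝ, K ⊆ WeakDual.toStrongDual ⁻¹' closedBall 0 C := by
    refine ⟨measureUnivNNReal μ ^ (2 : ℝ≥0∞).toReal⁻¹ * |M|, fun l hl => ?_⟩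
    · rw [mem_preimage, mem_closedBall_zero_iff]
      have : ‖WeakDual.toStrongDual l‖ = ‖T l‖ := by
        simp [T]
      rw [this]
      refine Lp.norm_le_of_ae_bound (abs_nonneg M) ?_
      filter_upwards [hKb l hl] with x hx using hMm _ hx
  have hKc : IsCompact K := (WeakDual.isCompact_closedBall 0 C).of_isClosed_subset hKclosed hC
  have hcont : ContinuousOn (fun l => ∫ z, k z * (T l z.1 * T l z.2) ∂(μ.prod μ)) K := by
    refine wc_cont hm (w := fun l => T l) (fun l _ => (hTi l).aestronglyMeasurable) hKb ?_ hk
    intro s hs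
    refine ((hev (I s hs)).continuousOn).congr ?_
    intro l _
    exact (hT l s hs).symm
  have hemb : ∀ v : α → ℝ, AEStronglyMeasurable v μ → ∫ x, v x ∂μ = 1 →
      (∀ᵐ x ∂μ, m ≤ v x ∧ v x ≤ M) → ∃ l ∈ K, T l =ᵐ[μ] v := by
    intro v hv hv1 hvb
    have hmem : MemLp v 2 μ := MemLp.of_bound hv |M| (by
      filter_upwards [hvb] with x hx using hMm _ hx)
    have hvi : Integrable v μ := hmem.integrable (by norm_num)
    let l : WeakDual ℝ (Lp ℝ 2 μ) := WeakDual.toStrongDual.symm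
      (InnerProductSpace.toDual ℝ (Lp ℝ 2 μ) hmem.toLp)
    have hTl : T l = hmem.toLp := by simp [T, l]
    have hae : T l =ᵐ[μ] v := by rw [hTl]; exact hmem.coeFn_toLp
    refine ⟨l, ⟨?_, ?_⟩, hae⟩
    · rw [hT, setIntegral_univ, integral_congr_ae hae, hv1]
    · intro s hs
      rw [hT, setIntegral_congr_ae hs (hae.mono fun x hx _ => hx)]
      have e : ∀ c : ℝ, c * μ.real s = ∫ x in s, c ∂μ := fun c => by
        rw [setIntegral_const, smul_eq_mul, mul_comm]
      rw [e, e]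
      constructor
      · exact integral_mono_ae (integrable_const _) hvi.integrableOn
          (ae_restrict_of_ae (hvb.mono fun x hx => hx.1))
      · exact integral_mono_ae hvi.integrableOn (integrable_const _)
          (ae_restrict_of_ae (hvb.mono fun x hx => hx.2))
  obtain ⟨l₀, hl₀, _⟩ := hemb w₀ hw₀ hw₀1 hw₀b
  obtain ⟨l, hl, hmax⟩ := hKc.exists_isMaxOn ⟨l₀, hl₀⟩ hcont
  refine ⟨T l, (hTi l).aestronglyMeasurable, ?_, hKb l hl, ?_⟩
  · rw [← setIntegral_univ, ← hT l univ MeasurableSet.univ]; exact hl.1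
  · intro v hv hv1 hvb
    obtain ⟨l', hl', hae⟩ := hemb v hv hv1 hvb
    have := hmax hl'
    simp only [mem_ofPred_eq] at this
    refine le_trans (le_of_eq ?_) this
    refine integral_congr_ae ?_
    filter_upwards [Measure.quasiMeasurePreserving_fst.ae (p := fun x => T l' x = v x) hae,
      Measure.quasiMeasurePreserving_snd.ae (p := fun x => T l' x = v x) hae] with z h1 h2
    rw [h1, h2]

section core
variable {d : ℕ}

theorem ker_integrable {g : ℝ → ℝ} (hg : Antitone g) {C : ℝ} (hgb : ∀ t, 0 ≤ g t ∧ g t ≤ C)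
    {p q : EuclideanSpace ℝ (Fin d) → EuclideanSpace ℝ (Fin d)} (hp : Continuous p)
    (hq : Continuous q)
    {a b : EuclideanSpace ℝ (Fin d) → ℝ} (ha : Integrable a) (hb : Integrable b) :
    Integrable (fun z : EuclideanSpace ℝ (Fin d) × EuclideanSpace ℝ (Fin d) =>
      g (dist (p z.1) (q z.2)) * (a z.1 * b z.2)) (volume.prod volume) := by
  refine Integrable.bdd_mul (c := C) (ha.mul_prod hb) ?_ ?_
  · refine Measurable.aestronglyMeasurable (hg.measurable.comp ?_)
    exact Continuous.measurable (by fun_prop)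
  · refine Eventually.of_forall fun z => ?_
    rw [Real.norm_eq_abs, abs_of_nonneg (hgb _).1]
    exact (hgb _).2

/-- the bilinear form -/
noncomputable def bform (g : ℝ → ℝ) (u v : EuclideanSpace ℝ (Fin d) → ℝ) : ℝ :=
  ∫ z : EuclideanSpace ℝ (Fin d) × EuclideanSpace ℝ (Fin d),
    g (dist z.1 z.2) * (u z.1 * v z.2) ∂(volume.prod volume)

theorem refl_dist {σ : EuclideanSpace ℝ (Fin d) → EuclideanSpace ℝ (Fin d)}
    {h : EuclideanSpace ℝ (Fin d) → ℝ} {κ : ℝ}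
    (h1 : ∀ x, h (σ x) = - h x)
    (h2 : ∀ x y, dist x (σ y) ^ 2 = dist x y ^ 2 + κ * (h x * h y)) :
    (∀ x y, dist (σ x) y = dist x (σ y)) ∧ (∀ x y, dist (σ x) (σ y) = dist x y) := by
  constructor
  · intro x y
    rw [← sq_eq_sq₀ dist_nonneg dist_nonneg, dist_comm, h2, h2, dist_comm, mul_comm (h x)]
  · intro x y
    rw [← sq_eq_sq₀ dist_nonneg dist_nonneg, h2, dist_comm, h2, h1, dist_comm]
    ring

theorem bform_decomp {g : ℝ → ℝ} (hg : Antitone g) {C : ℝ} (hgb : ∀ t, 0 ≤ g t ∧ g t ≤ C)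
    {σ : EuclideanSpace ℝ (Fin d) → EuclideanSpace ℝ (Fin d)}
    {h : EuclideanSpace ℝ (Fin d) → ℝ} {κ : ℝ}
    (hσ : MeasurePreserving σ volume volume) (hσc : Continuous σ) (hinv : ∀ x, σ (σ x) = x)
    (h1 : ∀ x, h (σ x) = - h x)
    (h2 : ∀ x y, dist x (σ y) ^ 2 = dist x y ^ 2 + κ * (h x * h y))
    {v : EuclideanSpace ℝ (Fin d) → ℝ} (hv : Integrable v) :
    8 * bform g v v = ∫ z : EuclideanSpace ℝ (Fin d) × EuclideanSpace ℝ (Fin d),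
      ((g (dist z.1 z.2) + g (dist z.1 (σ z.2))) * ((v z.1 + v (σ z.1)) * (v z.2 + v (σ z.2))) +
      (g (dist z.1 z.2) - g (dist z.1 (σ z.2))) * ((v z.1 - v (σ z.1)) * (v z.2 - v (σ z.2))))
        ∂(volume.prod volume) := by
  obtain ⟨d1, d2⟩ := refl_dist h1 h2
  have hvσ : Integrable (fun x => v (σ x)) := hσ.integrable_comp_of_integrable hv
  have hemb : MeasurableEmbedding σ := by
    let e : EuclideanSpace ℝ (Fin d) ≃ᵐ EuclideanSpace ℝ (Fin d) :=
      { toFun := σ, invFun := σ, left_inv := hinv, right_inv := hinv,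
        measurable_toFun := hσc.measurable, measurable_invFun := hσc.measurable }
    exact e.measurableEmbedding
  have hid : MeasurePreserving (id : EuclideanSpace ℝ (Fin d) → EuclideanSpace ℝ (Fin d))
    volume volume := MeasurePreserving.id _
  have e1 : bform g v v = ∫ z : EuclideanSpace ℝ (Fin d) × EuclideanSpace ℝ (Fin d),
      g (dist z.1 z.2) * (v (σ z.1) * v (σ z.2)) ∂(volume.prod volume) := by
    rw [bform, ← (hσ.prod hσ).integral_comp (hemb.prodMap hemb)]
    simp only [Prod.map_fst, Prod.map_snd, d2]
  have e2 : bform g v v = ∫ z : EuclideanSpace ℝ (Fin d) × EuclideanSpace ℝ (Fin d),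
      g (dist z.1 (σ z.2)) * (v z.1 * v (σ z.2)) ∂(volume.prod volume) := by
    rw [bform, ← (hid.prod hσ).integral_comp (MeasurableEmbedding.id.prodMap hemb)]
    simp only [Prod.map_fst, Prod.map_snd, id]
  have e3 : bform g v v = ∫ z : EuclideanSpace ℝ (Fin d) × EuclideanSpace ℝ (Fin d),
      g (dist z.1 (σ z.2)) * (v (σ z.1) * v z.2) ∂(volume.prod volume) := by
    rw [bform, ← (hσ.prod hid).integral_comp (hemb.prodMap MeasurableEmbedding.id)]
    simp only [Prod.map_fst, Prod.map_snd, id, d1]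
  have i0 := ker_integrable hg hgb continuous_id continuous_id hv hv
  have i1 := ker_integrable hg hgb continuous_id continuous_id hvσ hvσ
  have i2 := ker_integrable hg hgb continuous_id hσc hv hvσ
  have i3 := ker_integrable hg hgb continuous_id hσc hvσ hv
  simp only [id] at i0 i1 i2 i3
  have key : 8 * bform g v v = 2 * (((bform g v v + bform g v v) + bform g v v) + bform g v v) := by
    ring
  rw [key]
  nth_rewrite 2 [e1]
  nth_rewrite 2 [e2]
  nth_rewrite 2 [e3]
  have a1 := integral_add i0 i1
  have a2 := integral_add (i0.add i1) i2
  have a3 := integral_add ((i0.add i1).add i2) i3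
  simp only [Pi.add_apply] at a1 a2 a3
  rw [bform, ← a1, ← a2, ← a3, ← integral_const_mul]
  congr 1
  funext z
  ring

/-- polarization -/
noncomputable def polar (σ : EuclideanSpace ℝ (Fin d) → EuclideanSpace ℝ (Fin d))
    (h : EuclideanSpace ℝ (Fin d) → ℝ) (u : EuclideanSpace ℝ (Fin d) → ℝ)
    (x : EuclideanSpace ℝ (Fin d)) : ℝ :=
  (u x + u (σ x) + Real.sign (h x) * |u x - u (σ x)|) / 2

theorem sign_measurable' : Measurable Real.sign := by
  unfold Real.sign
  exact Measurable.ite measurableSet_Iio measurable_const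
    (Measurable.ite measurableSet_Ioi measurable_const measurable_const)

theorem polar_integrable {σ : EuclideanSpace ℝ (Fin d) → EuclideanSpace ℝ (Fin d)}
    {h : EuclideanSpace ℝ (Fin d) → ℝ} (hh : Continuous h)
    (hσ : MeasurePreserving σ volume volume)
    {u : EuclideanSpace ℝ (Fin d) → ℝ} (hu : Integrable u) :
    Integrable (fun x => Real.sign (h x) * |u x - u (σ x)|) ∧ Integrable (polar σ h u) := by
  have huσ : Integrable (fun x => u (σ x)) := hσ.integrable_comp_of_integrable hu
  have i : Integrable (fun x => Real.sign (h x) * |u x - u (σ x)|) := by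
    refine Integrable.bdd_mul (c := 1) (hu.sub huσ).abs ?_ ?_
    · exact (sign_measurable'.comp hh.measurable).aestronglyMeasurable
    · refine Eventually.of_forall fun x => ?_
      rcases Real.sign_apply_eq (h x) with e | e | e <;> simp [e]
  exact ⟨i, ((hu.add huσ).add i).div_const 2⟩

theorem polar_bform {g : ℝ → ℝ} (hg : Antitone g) (hgs : StrictAntiOn g (Ici 0))
    {C : ℝ} (hgb : ∀ t, 0 ≤ g t ∧ g t ≤ C)
    {σ : EuclideanSpace ℝ (Fin d) → EuclideanSpace ℝ (Fin d)}
    {h : EuclideanSpace ℝ (Fin d) → ℝ} {κ : ℝ} (hκ : 0 < κ) (hh : Continuous h)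
    (hσ : MeasurePreserving σ volume volume) (hσc : Continuous σ) (hinv : ∀ x, σ (σ x) = x)
    (h1 : ∀ x, h (σ x) = - h x)
    (h2 : ∀ x y, dist x (σ y) ^ 2 = dist x y ^ 2 + κ * (h x * h y))
    {u : EuclideanSpace ℝ (Fin d) → ℝ} (hu : Integrable u)
    (hle : bform g (polar σ h u) (polar σ h u) ≤ bform g u u) :
    ∀ᵐ z : EuclideanSpace ℝ (Fin d) × EuclideanSpace ℝ (Fin d) ∂(volume.prod volume),
      0 ≤ (h z.1 * (u z.1 - u (σ z.1))) * (h z.2 * (u z.2 - u (σ z.2))) := by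
  have huσ : Integrable (fun x => u (σ x)) := hσ.integrable_comp_of_integrable hu
  obtain ⟨isg, ip⟩ := polar_integrable hh hσ hu
  have ps : ∀ x, polar σ h u x + polar σ h u (σ x) = u x + u (σ x) := by
    intro x
    simp only [polar, hinv, h1, Real.sign_neg, abs_sub_comm (u (σ x)) (u x)]; ring
  have pd : ∀ x, polar σ h u x - polar σ h u (σ x) = Real.sign (h x) * |u x - u (σ x)| := by
    intro x
    simp only [polar, hinv, h1, Real.sign_neg, abs_sub_comm (u (σ x)) (u x)]; ring
  have e1 := bform_decomp hg hgb hσ hσc hinv h1 h2 hu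
  have e2 := bform_decomp hg hgb hσ hσc hinv h1 h2 ip
  simp only [ps, pd] at e2
  have hs := hu.add huσ
  have hd := hu.sub huσ
  have hid : Continuous (id : EuclideanSpace ℝ (Fin d) → _) := continuous_id
  have i1 := ker_integrable hg hgb hid hid hs hs
  have i2 := ker_integrable hg hgb hid hσc hs hs
  have i3 := ker_integrable hg hgb hid hid hd hd
  have i4 := ker_integrable hg hgb hid hσc hd hd
  have i5 := ker_integrable hg hgb hid hid isg isg
  have i6 := ker_integrable hg hgb hid hσc isg isg
  simp only [id, Pi.add_apply, Pi.sub_apply] at i1 i2 i3 i4 i5 i6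
  have j1 := (i1.add i2).add (i3.sub i4)
  have j2 := (i1.add i2).add (i5.sub i6)
  let Q : EuclideanSpace ℝ (Fin d) × EuclideanSpace ℝ (Fin d) → ℝ := fun z =>
    (g (dist z.1 z.2) - g (dist z.1 (σ z.2))) *
      ((Real.sign (h z.1) * |u z.1 - u (σ z.1)|) * (Real.sign (h z.2) * |u z.2 - u (σ z.2)|) -
        (u z.1 - u (σ z.1)) * (u z.2 - u (σ z.2)))
  have hQint : 8 * bform g (polar σ h u) (polar σ h u) - 8 * bform g u u =
      ∫ z, Q z ∂(volume.prod volume) := by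
    rw [e1, e2, ← integral_sub]
    · congr 1
      funext z
      simp only [Q]
      ring
    · refine j2.congr (Eventually.of_forall fun z => ?_)
      simp only [Pi.add_apply, Pi.sub_apply]
      ring
    · refine j1.congr (Eventually.of_forall fun z => ?_)
      simp only [Pi.add_apply, Pi.sub_apply]
      ring
  have hQi : Integrable Q (volume.prod volume) := by
    refine (j2.sub j1).congr (Eventually.of_forall fun z => ?_)
    simp only [Pi.add_apply, Pi.sub_apply, Q]
    ring
  have hpos : ∀ x y, 0 < h x * h y → g (dist x (σ y)) < g (dist x y) := by
    intro x y hxy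
    refine hgs dist_nonneg dist_nonneg ?_
    rw [← sq_lt_sq₀ dist_nonneg dist_nonneg, h2]
    have := mul_pos hκ hxy
    linarith
  have hneg : ∀ x y, h x * h y < 0 → g (dist x y) < g (dist x (σ y)) := by
    intro x y hxy
    refine hgs dist_nonneg dist_nonneg ?_
    rw [← sq_lt_sq₀ dist_nonneg dist_nonneg, h2]
    have := mul_neg_of_pos_of_neg hκ hxy
    linarith
  have hzero : ∀ x y, h x * h y = 0 → g (dist x y) = g (dist x (σ y)) := by
    intro x y hxy
    congr 1
    rw [← sq_eq_sq₀ dist_nonneg dist_nonneg, h2, hxy]; ring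
  have hsg : ∀ x y, 0 < h x * h y → Real.sign (h x) * Real.sign (h y) = 1 := by
    intro x y hxy
    rcases pos_and_pos_or_neg_and_neg_of_mul_pos hxy with ⟨a, b⟩ | ⟨a, b⟩
    · rw [Real.sign_of_pos a, Real.sign_of_pos b]; ring
    · rw [Real.sign_of_neg a, Real.sign_of_neg b]; ring
  have hsg' : ∀ x y, h x * h y < 0 → Real.sign (h x) * Real.sign (h y) = -1 := by
    intro x y hxy
    rcases mul_neg_iff.1 hxy with ⟨a, b⟩ | ⟨a, b⟩
    · rw [Real.sign_of_pos a, Real.sign_of_neg b]; ring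
    · rw [Real.sign_of_neg a, Real.sign_of_pos b]; ring
  have hre : ∀ z, Q z = (g (dist z.1 z.2) - g (dist z.1 (σ z.2))) *
      ((Real.sign (h z.1) * Real.sign (h z.2)) * |(u z.1 - u (σ z.1)) * (u z.2 - u (σ z.2))| -
        (u z.1 - u (σ z.1)) * (u z.2 - u (σ z.2))) := by
    intro z
    simp only [Q, abs_mul]
    ring
  have hQ0 : ∀ z, 0 ≤ Q z := by
    intro z
    rw [hre]
    rcases lt_trichotomy (h z.1 * h z.2) 0 with hz | hz | hz
    · rw [hsg' _ _ hz]
      have := hneg _ _ hz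
      refine mul_nonneg_of_nonpos_of_nonpos (by linarith) ?_
      linarith [neg_abs_le ((u z.1 - u (σ z.1)) * (u z.2 - u (σ z.2)))]
    · rw [hzero _ _ hz]; simp
    · rw [hsg _ _ hz]
      have := hpos _ _ hz
      refine mul_nonneg (by linarith) ?_
      linarith [le_abs_self ((u z.1 - u (σ z.1)) * (u z.2 - u (σ z.2)))]
  have hQ1 : ∫ z, Q z ∂(volume.prod volume) = 0 :=
    le_antisymm (by rw [← hQint]; linarith) (integral_nonneg hQ0)
  have hae := (integral_eq_zero_iff_of_nonneg hQ0 hQi).1 hQ1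
  filter_upwards [hae] with z hz
  rw [hre] at hz
  simp only [Pi.zero_apply] at hz
  have hr : (h z.1 * (u z.1 - u (σ z.1))) * (h z.2 * (u z.2 - u (σ z.2))) =
    (h z.1 * h z.2) * ((u z.1 - u (σ z.1)) * (u z.2 - u (σ z.2))) := by ring
  rw [hr]
  rcases lt_trichotomy (h z.1 * h z.2) 0 with hz' | hz' | hz'
  · rw [hsg' _ _ hz'] at hz
    have h3 := hneg _ _ hz'
    rcases mul_eq_zero.1 hz with h4 | h4
    · linarith
    · refine mul_nonneg_of_nonpos_of_nonpos hz'.le ?_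
      linarith [abs_nonneg ((u z.1 - u (σ z.1)) * (u z.2 - u (σ z.2)))]
  · rw [hz', zero_mul]
  · rw [hsg _ _ hz'] at hz
    have h3 := hpos _ _ hz'
    rcases mul_eq_zero.1 hz with h4 | h4
    · linarith
    · refine mul_nonneg hz'.le ?_
      linarith [abs_nonneg ((u z.1 - u (σ z.1)) * (u z.2 - u (σ z.2)))]

/-- potential -/
noncomputable def pot (g : ℝ → ℝ) (u : EuclideanSpace ℝ (Fin d) → ℝ) (x : EuclideanSpace ℝ (Fin d)) : ℝ :=
  ∫ y, g (dist x y) * u y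

theorem pot_integrand {g : ℝ → ℝ} (hg : Antitone g) {C : ℝ} (hgb : ∀ t, 0 ≤ g t ∧ g t ≤ C)
    {q : EuclideanSpace ℝ (Fin d) → EuclideanSpace ℝ (Fin d)} (hq : Continuous q)
    {u : EuclideanSpace ℝ (Fin d) → ℝ} (hu : Integrable u) (x : EuclideanSpace ℝ (Fin d)) :
    Integrable (fun y => g (dist x (q y)) * u y) := by
  refine Integrable.bdd_mul (c := C) hu ?_ ?_
  · refine Measurable.aestronglyMeasurable (hg.measurable.comp ?_)
    exact Continuous.measurable (by fun_prop)
  · refine Eventually.of_forall fun z => ?_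
    rw [Real.norm_eq_abs, abs_of_nonneg (hgb _).1]
    exact (hgb _).2

theorem pot_mono {g : ℝ → ℝ} (hg : Antitone g) {C : ℝ} (hgb : ∀ t, 0 ≤ g t ∧ g t ≤ C)
    {σ : EuclideanSpace ℝ (Fin d) → EuclideanSpace ℝ (Fin d)}
    {h : EuclideanSpace ℝ (Fin d) → ℝ} {κ : ℝ} (hκ : 0 < κ)
    (hσ : MeasurePreserving σ volume volume) (hσc : Continuous σ) (hinv : ∀ x, σ (σ x) = x)
    (h1 : ∀ x, h (σ x) = - h x)
    (h2 : ∀ x y, dist x (σ y) ^ 2 = dist x y ^ 2 + κ * (h x * h y))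
    {u : EuclideanSpace ℝ (Fin d) → ℝ} (hu : Integrable u)
    (hD : ∀ᵐ y, 0 ≤ h y * (u y - u (σ y))) {a : EuclideanSpace ℝ (Fin d)} (ha : 0 < h a) :
    pot g u (σ a) ≤ pot g u a := by
  obtain ⟨d1, d2⟩ := refl_dist h1 h2
  have huσ : Integrable (fun x => u (σ x)) := hσ.integrable_comp_of_integrable hu
  have hemb : MeasurableEmbedding σ := by
    let e : EuclideanSpace ℝ (Fin d) ≃ᵐ EuclideanSpace ℝ (Fin d) :=
      { toFun := σ, invFun := σ, left_inv := hinv, right_inv := hinv,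
        measurable_toFun := hσc.measurable, measurable_invFun := hσc.measurable }
    exact e.measurableEmbedding
  have e1 : pot g u (σ a) = ∫ y, g (dist a (σ y)) * u y := by
    rw [pot]; simp only [d1]
  have e2 : pot g u (σ a) = ∫ y, g (dist a y) * u (σ y) := by
    rw [pot, ← hσ.integral_comp hemb]; simp only [d2]
  have e3 : pot g u a = ∫ y, g (dist a (σ y)) * u (σ y) := by
    rw [pot, ← hσ.integral_comp hemb]
  have i0 := pot_integrand hg hgb continuous_id hu a
  have i1 := pot_integrand hg hgb hσc hu a
  have i2 := pot_integrand hg hgb continuous_id huσ a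
  have i3 := pot_integrand hg hgb hσc huσ a
  simp only [id] at i0 i2
  have key : (pot g u a - pot g u (σ a)) + (pot g u a - pot g u (σ a)) =
      ∫ y, (g (dist a y) - g (dist a (σ y))) * (u y - u (σ y)) := by
    nth_rewrite 1 [e2]
    rw [e1, e3]
    nth_rewrite 1 [← e3]
    have a1 := integral_add (i0.sub i2) (i3.sub i1)
    simp only [Pi.sub_apply] at a1
    rw [pot, ← integral_sub i0 i2, ← integral_sub i3 i1, ← a1]
    congr 1
    funext y
    ring
  have : 0 ≤ ∫ y, (g (dist a y) - g (dist a (σ y))) * (u y - u (σ y)) := by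
    refine integral_nonneg_of_ae ?_
    filter_upwards [hD] with y hy
    simp only [Pi.zero_apply]
    have hd := h2 a y
    rcases lt_trichotomy (h y) 0 with hz | hz | hz
    · refine mul_nonneg_of_nonpos_of_nonpos ?_ ?_
      · have : dist a (σ y) ≤ dist a y := by
          rw [← sq_le_sq₀ dist_nonneg dist_nonneg, hd]
          have := mul_pos hκ (mul_pos ha (neg_pos.2 hz))
          linarith
        linarith [hg this]
      · by_contra hc
        push Not at hc
        linarith [mul_neg_of_neg_of_pos hz hc]
    · have : dist a (σ y) = dist a y := by
        rw [← sq_eq_sq₀ dist_nonneg dist_nonneg, hd, hz]; ring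
      rw [this]; simp
    · refine mul_nonneg ?_ ?_
      · have : dist a y ≤ dist a (σ y) := by
          rw [← sq_le_sq₀ dist_nonneg dist_nonneg, hd]
          have := mul_pos hκ (mul_pos ha hz)
          linarith
        linarith [hg this]
      · by_contra hc
        push Not at hc
        linarith [mul_neg_of_pos_of_neg hz hc]
  linarith
end core

section core2
variable {d : ℕ}

structure RAdm (R m M : ℝ) (u : EuclideanSpace ℝ (Fin d) → ℝ) : Prop where
  meas : Measurable u
  inside : ∀ x, ‖x‖ ≤ R → m ≤ u x ∧ u x ≤ M
  outside : ∀ x, R < ‖x‖ → u x = 0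
  int : Integrable u
  mass : ∫ x, u x = 1

theorem radm_ae {R m M : ℝ} (hmM : m ≤ M) {w : EuclideanSpace ℝ (Fin d) → ℝ}
    (hw : AEStronglyMeasurable w (volume.restrict (closedBall 0 R)))
    (hw1 : ∫ x in closedBall 0 R, w x = 1)
    (hb : ∀ᵐ x ∂(volume.restrict (closedBall (0 : EuclideanSpace ℝ (Fin d)) R)),
      m ≤ w x ∧ w x ≤ M) :
    ∃ u, RAdm R m M u ∧ u =ᵐ[volume.restrict (closedBall 0 R)] w := by
  have hfin : IsFiniteMeasure (volume.restrict (closedBall (0 : EuclideanSpace ℝ (Fin d)) R)) :=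
    ⟨by rw [Measure.restrict_apply_univ]; exact measure_closedBall_lt_top⟩
  let u : EuclideanSpace ℝ (Fin d) → ℝ := (closedBall 0 R).indicator
    (fun x => max m (min M (hw.mk w x)))
  have hum : Measurable u := by
    refine Measurable.indicator ?_ isClosed_closedBall.measurableSet
    exact measurable_const.max (measurable_const.min hw.stronglyMeasurable_mk.measurable)
  have hue : u =ᵐ[volume.restrict (closedBall 0 R)] w := by
    filter_upwards [hb, hw.ae_eq_mk, ae_restrict_mem isClosed_closedBall.measurableSet]
      with x h1 h2 h3
    simp only [u]
    rw [indicator_of_mem h3, ← h2, min_eq_right h1.2, max_eq_right h1.1]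
  have huin : ∀ x, ‖x‖ ≤ R → m ≤ u x ∧ u x ≤ M := by
    intro x hx
    simp only [u]
    rw [indicator_of_mem (by simpa using hx)]
    exact ⟨le_max_left _ _, max_le hmM (min_le_left _ _)⟩
  have hio : IntegrableOn u (closedBall 0 R) := by
    refine Integrable.of_bound (C := |m| + |M|) hum.aestronglyMeasurable ?_
    filter_upwards [ae_restrict_mem isClosed_closedBall.measurableSet] with x hx
    have := huin x (by simpa using hx)
    rw [Real.norm_eq_abs, abs_le]
    constructor
    · linarith [neg_abs_le m, abs_nonneg M]
    · linarith [le_abs_self M, abs_nonneg m]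
  have hout : ∀ x, R < ‖x‖ → u x = 0 := by
    intro x hx
    exact indicator_of_notMem (by simpa using hx) _
  have hout' : ∀ x, x ∉ closedBall 0 R → u x = 0 := fun x hx => hout x (by simpa using hx)
  refine ⟨u, ⟨hum, huin, hout, ?_, ?_⟩, hue⟩
  · exact (integrableOn_iff_integrable_of_support_subset (fun x hx => by
      by_contra hc
      exact hx (hout' x hc))).1 hio
  · rw [← setIntegral_eq_integral_of_forall_compl_eq_zero hout', integral_congr_ae hue, hw1]

theorem bform_restrict {R m M : ℝ} {u : EuclideanSpace ℝ (Fin d) → ℝ} (hu : RAdm R m M u)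
    (g : ℝ → ℝ) :
    ∫ z, g (dist z.1 z.2) * (u z.1 * u z.2) ∂((volume.restrict (closedBall 0 R)).prod
      (volume.restrict (closedBall 0 R))) = bform g u u := by
  rw [Measure.prod_restrict, setIntegral_eq_integral_of_forall_compl_eq_zero, bform]
  intro z hz
  rw [mem_prod, not_and_or] at hz
  rcases hz with hz | hz
  · rw [hu.outside z.1 (by simpa using hz)]; simp
  · rw [hu.outside z.2 (by simpa using hz)]; simp

theorem radm_polar {R m M : ℝ} (hm : 0 ≤ m)
    {σ : EuclideanSpace ℝ (Fin d) → EuclideanSpace ℝ (Fin d)}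
    {h : EuclideanSpace ℝ (Fin d) → ℝ} (hh : Continuous h)
    (hσ : MeasurePreserving σ volume volume) (hσc : Continuous σ) (hinv : ∀ x, σ (σ x) = x)
    (h1 : ∀ x, h (σ x) = - h x)
    (hlt : ∀ x, ‖x‖ < ‖σ x‖ → 0 < h x)
    {u : EuclideanSpace ℝ (Fin d) → ℝ} (hu : RAdm R m M u) :
    RAdm R m M (polar σ h u) := by
  obtain ⟨isg, ip⟩ := polar_integrable hh hσ hu.int
  have huσ : Integrable (fun x => u (σ x)) := hσ.integrable_comp_of_integrable hu.int
  have hemb : MeasurableEmbedding σ := by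
    let e : EuclideanSpace ℝ (Fin d) ≃ᵐ EuclideanSpace ℝ (Fin d) :=
      { toFun := σ, invFun := σ, left_inv := hinv, right_inv := hinv,
        measurable_toFun := hσc.measurable, measurable_invFun := hσc.measurable }
    exact e.measurableEmbedding
  have hmax : ∀ x, 0 < h x → polar σ h u x = max (u x) (u (σ x)) := by
    intro x hx
    rw [polar, Real.sign_of_pos hx]
    rcases le_total (u x) (u (σ x)) with e | e
    · rw [max_eq_right e, abs_of_nonpos (by linarith)]; ring
    · rw [max_eq_left e, abs_of_nonneg (by linarith)]; ring
  have hmin : ∀ x, h x < 0 → polar σ h u x = min (u x) (u (σ x)) := by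
    intro x hx
    rw [polar, Real.sign_of_neg hx]
    rcases le_total (u x) (u (σ x)) with e | e
    · rw [min_eq_left e, abs_of_nonpos (by linarith)]; ring
    · rw [min_eq_right e, abs_of_nonneg (by linarith)]; ring
  have hlt' : ∀ x, ‖σ x‖ < ‖x‖ → h x < 0 := by
    intro x hx
    have := hlt (σ x) (by rwa [hinv])
    rw [h1] at this
    linarith
  refine ⟨?_, ?_, ?_, ip, ?_⟩
  · have h3 : Measurable (fun x => u (σ x)) := hu.meas.comp hσc.measurable
    have h4 : Measurable (fun x => Real.sign (h x)) := sign_measurable'.comp hh.measurable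
    have h5 : Measurable (fun x => |u x - u (σ x)|) := (hu.meas.sub h3).abs
    exact ((hu.meas.add h3).add (h4.mul h5)).div_const 2
  · intro x hx
    have hux := hu.inside x hx
    rcases le_or_gt ‖σ x‖ R with hs | hs
    · have hus := hu.inside (σ x) hs
      rcases lt_trichotomy (h x) 0 with e | e | e
      · rw [hmin x e]; exact ⟨le_min hux.1 hus.1, (min_le_left _ _).trans hux.2⟩
      · rw [polar, e, Real.sign_zero]; constructor <;> linarith [hux.1, hux.2, hus.1, hus.2]
      · rw [hmax x e]; exact ⟨hux.1.trans (le_max_left _ _), max_le hux.2 hus.2⟩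
    · rw [hmax x (hlt x (by linarith)), hu.outside _ hs, max_eq_left (hm.trans hux.1)]
      exact hux
  · intro x hx
    rcases le_or_gt ‖σ x‖ R with hs | hs
    · have hus := hu.inside (σ x) hs
      rw [hmin x (hlt' x (by linarith)), hu.outside _ hx, min_eq_left (hm.trans hus.1)]
    · rw [polar, hu.outside _ hx, hu.outside _ hs]; simp
  · have e1 : ∫ x, u (σ x) = 1 := by rw [hσ.integral_comp hemb, hu.mass]
    have e2 : ∫ x, Real.sign (h x) * |u x - u (σ x)| = 0 := by
      have e := hσ.integral_comp hemb (fun x => Real.sign (h x) * |u x - u (σ x)|)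
      simp only [h1, hinv, Real.sign_neg] at e
      have e' : ∫ x, -Real.sign (h x) * |u (σ x) - u x| =
          - ∫ x, Real.sign (h x) * |u x - u (σ x)| := by
        rw [← integral_neg]
        congr 1
        funext x
        rw [abs_sub_comm]; ring
      linarith
    have a1 := integral_add hu.int huσ
    have a2 := integral_add (hu.int.add huσ) isg
    simp only [Pi.add_apply] at a2
    simp only [polar]
    rw [integral_div, a2, a1, e1, e2, hu.mass]; norm_num

/-- a maximizer has a radially decreasing potential -/
theorem max_pot {R m M : ℝ} (hR : 0 < R) (hm : 0 < m)
    {g : ℝ → ℝ} (hg : Antitone g) (hgs : StrictAntiOn g (Ici 0))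
    {C : ℝ} (hgb : ∀ t, 0 ≤ g t ∧ g t ≤ C)
    {u : EuclideanSpace ℝ (Fin d) → ℝ} (hu : RAdm R m M u)
    (hmax : ∀ v : EuclideanSpace ℝ (Fin d) → ℝ, RAdm R m M v → bform g v v ≤ bform g u u)
    (a b : EuclideanSpace ℝ (Fin d)) (hab : ‖a‖ < ‖b‖) : pot g u b ≤ pot g u a := by
  obtain ⟨σ, h, κ, hκ, hσ, hσc, hh, hinv, h1, h2, hσa, ha, h0⟩ := exists_refl a b hab
  obtain ⟨d1, d2⟩ := refl_dist h1 h2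
  have hnorm : ∀ x, ‖σ x‖ ^ 2 = ‖x‖ ^ 2 + κ * (h 0 * h x) := by
    intro x
    have := h2 0 x
    rwa [dist_zero_left, dist_zero_left] at this
  have hlt : ∀ x, ‖x‖ < ‖σ x‖ → 0 < h x := by
    intro x hx
    rw [← sq_lt_sq₀ (norm_nonneg _) (norm_nonneg _), hnorm] at hx
    by_contra hc
    push Not at hc
    have := mul_nonneg hκ.le (mul_nonneg h0.le (neg_nonneg.2 hc))
    linarith
  have hP := polar_bform hg hgs hgb hκ hh hσ hσc hinv h1 h2 hu.int
    (hmax _ (radm_polar hm.le hh hσ hσc hinv h1 hlt hu))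
  have hP2 := Measure.ae_ae_of_ae_prod hP
  simp only at hP2
  -- an open set where the sign is strictly positive
  have hopen : IsOpen {x : EuclideanSpace ℝ (Fin d) | ‖x‖ < R ∧ R < ‖σ x‖} :=
    (isOpen_lt continuous_norm continuous_const).inter
      (isOpen_lt continuous_const hσc.norm)
  have hne : {x : EuclideanSpace ℝ (Fin d) | ‖x‖ < R ∧ R < ‖σ x‖}.Nonempty := by
    have hc : 0 < ‖σ 0‖ := by
      have e := hnorm 0
      have := mul_pos hκ (mul_pos h0 h0)
      refine lt_of_le_of_ne (norm_nonneg _) fun hz => ?_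
      rw [← hz, norm_zero] at e
      linarith
    obtain ⟨t, ht0, ht1, ht2⟩ : ∃ t, 0 < t ∧ t < R ∧ R < t + ‖σ 0‖ := by
      refine ⟨max (R - ‖σ 0‖/2) (R/2), ?_, ?_, ?_⟩
      · exact lt_max_of_lt_right (by linarith)
      · exact max_lt (by linarith) (by linarith)
      · linarith [le_max_left (R - ‖σ 0‖/2) (R/2)]
    refine ⟨(-(t / ‖σ 0‖)) • σ 0, ?_, ?_⟩
    · rw [norm_smul, norm_neg, Real.norm_eq_abs, abs_of_pos (by positivity)]
      field_simp
      exact ht1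
    · have e : ‖σ ((-(t / ‖σ 0‖)) • σ 0)‖ = ‖(-(t / ‖σ 0‖)) • σ 0 - σ 0‖ := by
        rw [← dist_zero_right, d1, dist_eq_norm]
      have e2 : (-(t / ‖σ 0‖)) • σ 0 - σ 0 = (-((t + ‖σ 0‖) / ‖σ 0‖)) • σ 0 := by
        rw [add_div, div_self hc.ne']; module
      rw [e, e2, norm_smul, norm_neg, Real.norm_eq_abs, abs_of_pos (by positivity)]
      field_simp
      exact ht2
  have hpos := hopen.measure_pos volume hne
  obtain ⟨x, hx, hxae⟩ : ∃ x, (‖x‖ < R ∧ R < ‖σ x‖) ∧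
      ∀ᵐ y, 0 ≤ (h x * (u x - u (σ x))) * (h y * (u y - u (σ y))) := by
    by_contra hc
    refine hpos.ne' (measure_mono_null (fun x hx => ?_) (ae_iff.1 hP2))
    exact fun hx' => hc ⟨x, hx, hx'⟩
  have hDx : 0 < h x * (u x - u (σ x)) := by
    refine mul_pos (hlt x (hx.1.trans hx.2)) ?_
    rw [hu.outside _ hx.2]
    linarith [(hu.inside x hx.1.le).1]
  rw [← hσa]
  refine pot_mono hg hgb hκ hσ hσc hinv h1 h2 hu.int ?_ ha
  filter_upwards [hxae] with y hy
  by_contra hc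
  push Not at hc
  linarith [mul_neg_of_pos_of_neg hDx hc]

theorem rad_pot {g : ℝ → ℝ} (hg : Antitone g)
    {C : ℝ} (hgb : ∀ t, 0 ≤ g t ∧ g t ≤ C)
    {u : EuclideanSpace ℝ (Fin d) → ℝ} (hu : Integrable u)
    (hrad : ∀ x y, ‖x‖ < ‖y‖ → u y ≤ u x)
    (a b : EuclideanSpace ℝ (Fin d)) (hab : ‖a‖ < ‖b‖) : pot g u b ≤ pot g u a := by
  obtain ⟨σ, h, κ, hκ, hσ, hσc, hh, hinv, h1, h2, hσa, ha, h0⟩ := exists_refl a b hab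
  have hnorm : ∀ x, ‖σ x‖ ^ 2 = ‖x‖ ^ 2 + κ * (h 0 * h x) := by
    intro x
    have := h2 0 x
    rwa [dist_zero_left, dist_zero_left] at this
  rw [← hσa]
  refine pot_mono hg hgb hκ hσ hσc hinv h1 h2 hu ?_ ha
  refine Eventually.of_forall fun y => ?_
  rcases lt_trichotomy (h y) 0 with hz | hz | hz
  · refine mul_nonneg_of_nonpos_of_nonpos hz.le ?_
    have := hrad (σ y) y (by
      rw [← sq_lt_sq₀ (norm_nonneg _) (norm_nonneg _), hnorm]
      have := mul_pos hκ (mul_pos h0 (neg_pos.2 hz))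
      linarith)
    linarith
  · rw [hz, zero_mul]
  · refine mul_nonneg hz.le ?_
    have := hrad y (σ y) (by
      rw [← sq_lt_sq₀ (norm_nonneg _) (norm_nonneg _), hnorm]
      have := mul_pos hκ (mul_pos h0 hz)
      linarith)
    linarith

theorem bform_pot {g : ℝ → ℝ} (hg : Antitone g)
    {C : ℝ} (hgb : ∀ t, 0 ≤ g t ∧ g t ≤ C)
    {u v : EuclideanSpace ℝ (Fin d) → ℝ} (hu : Integrable u) (hv : Integrable v) :
    Integrable (fun x => pot g u x * v x) ∧
    bform g v u = ∫ x, pot g u x * v x := by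
  have i := ker_integrable hg hgb continuous_id continuous_id hv hu
  simp only [id] at i
  have e : ∀ x, ∫ y, g (dist x y) * (v x * u y) = pot g u x * v x := by
    intro x
    rw [pot, ← integral_mul_const]
    congr 1
    funext y
    ring
  constructor
  · have := i.integral_prod_left
    simpa only [e] using this
  · rw [bform, integral_prod _ i]
    simp only [e]

theorem bform_comm {g : ℝ → ℝ} (u v : EuclideanSpace ℝ (Fin d) → ℝ) :
    bform g u v = bform g v u := by
  rw [bform, bform, ← integral_prod_swap]
  congr 1
  funext z
  simp only [Prod.fst_swap, Prod.snd_swap]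
  rw [dist_comm]; ring

theorem bathtub {R m M r : ℝ} (hm : 0 < m) (hr : 0 ≤ r)
    {g : ℝ → ℝ} (hg : Antitone g)
    {C : ℝ} (hgb : ∀ t, 0 ≤ g t ∧ g t ≤ C)
    {u v w : EuclideanSpace ℝ (Fin d) → ℝ} (hu : RAdm R m M u) (hv : RAdm R m M v)
    (hw : RAdm R m M w)
    (hw1 : ∀ x, ‖x‖ ≤ R → ‖x‖ ≤ r → w x = M) (hw2 : ∀ x, ‖x‖ ≤ R → r < ‖x‖ → w x = m)
    (hpot : ∀ a b, ‖a‖ < ‖b‖ → pot g u b ≤ pot g u a) :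
    bform g v u ≤ bform g w u := by
  have hu0 : ∀ x, 0 ≤ u x := by
    intro x
    rcases le_or_gt ‖x‖ R with h | h
    · exact hm.le.trans (hu.inside x h).1
    · rw [hu.outside x h]
  have hp0 : ∀ x, 0 ≤ pot g u x := fun x =>
    integral_nonneg fun y => mul_nonneg (hgb _).1 (hu0 y)
  obtain ⟨iv, ev⟩ := bform_pot hg hgb hu.int hv.int
  obtain ⟨iw, ew⟩ := bform_pot hg hgb hu.int hw.int
  let c : ℝ := sInf (pot g u '' closedBall 0 r)
  have hbdd : BddBelow (pot g u '' closedBall 0 r) :=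
    ⟨0, by rintro _ ⟨x, _, rfl⟩; exact hp0 x⟩
  have hcle : ∀ x, ‖x‖ ≤ r → c ≤ pot g u x := fun x hx =>
    csInf_le hbdd ⟨x, by simpa using hx, rfl⟩
  have hlec : ∀ x, r < ‖x‖ → pot g u x ≤ c := by
    intro x hx
    refine le_csInf ⟨_, 0, by simpa using hr, rfl⟩ ?_
    rintro _ ⟨y, hy, rfl⟩
    exact hpot y x (lt_of_le_of_lt (by simpa using hy) hx)
  have hpt : ∀ x, 0 ≤ (pot g u x - c) * (w x - v x) := by
    intro x
    rcases le_or_gt ‖x‖ R with h | h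
    · rcases le_or_gt ‖x‖ r with h' | h'
      · rw [hw1 x h h']
        exact mul_nonneg (by linarith [hcle x h']) (by linarith [(hv.inside x h).2])
      · rw [hw2 x h h']
        exact mul_nonneg_of_nonpos_of_nonpos (by linarith [hlec x h'])
          (by linarith [(hv.inside x h).1])
    · rw [hw.outside x h, hv.outside x h]; simp
  have hI : 0 ≤ ∫ x, (pot g u x - c) * (w x - v x) := integral_nonneg hpt
  have e1 : ∫ x, (pot g u x - c) * (w x - v x) =
      ((∫ x, pot g u x * w x) - ∫ x, pot g u x * v x) - c * ((∫ x, w x) - ∫ x, v x) := by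
    have a1 := integral_sub (iw.sub iv) ((hw.int.sub hv.int).const_mul c)
    simp only [Pi.sub_apply] at a1
    rw [← integral_sub iw iv, ← integral_sub hw.int hv.int, ← integral_const_mul, ← a1]
    congr 1
    funext x
    ring
  rw [e1, hw.mass, hv.mass] at hI
  rw [ev, ew]
  linarith

theorem core_thm {R m M r : ℝ} (hR : 0 < R) (hm : 0 < m) (hmM : m ≤ M) (hr : 0 ≤ r)
    {g : ℝ → ℝ} (hg : Antitone g) (hgs : StrictAntiOn g (Ici 0))
    {C : ℝ} (hgb : ∀ t, 0 ≤ g t ∧ g t ≤ C)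
    {v w : EuclideanSpace ℝ (Fin d) → ℝ} (hv : RAdm R m M v)
    (hw : RAdm R m M w)
    (hw1 : ∀ x, ‖x‖ ≤ R → ‖x‖ ≤ r → w x = M) (hw2 : ∀ x, ‖x‖ ≤ R → r < ‖x‖ → w x = m) :
    bform g v v ≤ bform g w w := by
  have hfin : IsFiniteMeasure (volume.restrict (closedBall (0 : EuclideanSpace ℝ (Fin d)) R)) :=
    ⟨by rw [Measure.restrict_apply_univ]; exact measure_closedBall_lt_top⟩
  have hprop : ∀ u : EuclideanSpace ℝ (Fin d) → ℝ, RAdm R m M u →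
      AEStronglyMeasurable u (volume.restrict (closedBall 0 R)) ∧
      ∫ x in closedBall 0 R, u x = 1 ∧
      ∀ᵐ x ∂(volume.restrict (closedBall (0 : EuclideanSpace ℝ (Fin d)) R)),
        m ≤ u x ∧ u x ≤ M := by
    intro u hu
    refine ⟨hu.meas.aestronglyMeasurable, ?_, ?_⟩
    · rw [setIntegral_eq_integral_of_forall_compl_eq_zero, hu.mass]
      intro x hx
      exact hu.outside x (by simpa using hx)
    · filter_upwards [ae_restrict_mem isClosed_closedBall.measurableSet] with x hx
      exact hu.inside x (by simpa using hx)
  have hk : Integrable (fun z : EuclideanSpace ℝ (Fin d) × EuclideanSpace ℝ (Fin d) =>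
      g (dist z.1 z.2)) ((volume.restrict (closedBall 0 R)).prod
      (volume.restrict (closedBall 0 R))) := by
    refine Integrable.of_bound (C := C) ?_ ?_
    · exact (hg.measurable.comp (by fun_prop)).aestronglyMeasurable
    · refine Eventually.of_forall fun z => ?_
      rw [Real.norm_eq_abs, abs_of_nonneg (hgb _).1]
      exact (hgb _).2
  obtain ⟨w1, w2, w3⟩ := hprop w hw
  obtain ⟨u₀, u1, u2, u3, u4⟩ := exists_max hm.le hk w1 w2 w3
  obtain ⟨u, hu, hue⟩ := radm_ae hmM u1 u2 u3
  have hmax : ∀ v : EuclideanSpace ℝ (Fin d) → ℝ, RAdm R m M v → bform g v v ≤ bform g u u := by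
    intro v hv
    obtain ⟨v1, v2, v3⟩ := hprop v hv
    have := u4 v v1 v2 v3
    rw [← bform_restrict hv, ← bform_restrict hu]
    refine this.trans (le_of_eq ?_)
    refine integral_congr_ae ?_
    filter_upwards [Measure.quasiMeasurePreserving_fst.ae (p := fun x => u x = u₀ x) hue,
      Measure.quasiMeasurePreserving_snd.ae (p := fun x => u x = u₀ x) hue] with z h1 h2
    rw [h1, h2]
  have hrad : ∀ x y, ‖x‖ < ‖y‖ → w y ≤ w x := by
    intro x y hxy
    rcases le_or_gt ‖y‖ R with h | h
    · have hx : ‖x‖ ≤ R := hxy.le.trans h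
      rcases le_or_gt ‖x‖ r with h' | h'
      · rw [hw1 x hx h']; exact (hw.inside y h).2
      · rw [hw2 x hx h', hw2 y h (h'.trans hxy)]
    · rw [hw.outside y h]
      rcases le_or_gt ‖x‖ R with h' | h'
      · exact hm.le.trans (hw.inside x h').1
      · rw [hw.outside x h']
  calc bform g v v ≤ bform g u u := hmax v hv
    _ ≤ bform g w u := bathtub hm hr hg hgb hu hu hw hw1 hw2 (max_pot hR hm hg hgs hgb hu hmax)
    _ = bform g u w := bform_comm _ _
    _ ≤ bform g w w := bathtub hm hr hg hgb hw hu hw hw1 hw2 (rad_pot hg hgb hw.int hrad)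
end core2

theorem vol_ball_real {d : ℕ} (hd : 0 < d) {r : ℝ} (hr : 0 ≤ r) :
    volume.real (closedBall (0 : EuclideanSpace ℝ (Fin d)) r) = ballVol d * r ^ d := by
  haveI : Nonempty (Fin d) := ⟨⟨0, hd⟩⟩
  rw [Measure.real, EuclideanSpace.volume_closedBall, ENNReal.toReal_mul, ENNReal.toReal_pow,
    ENNReal.toReal_ofReal hr, ENNReal.toReal_ofReal, ballVol, Fintype.card_fin, mul_comm]
  · congr 2
    rw [Real.sqrt_eq_rpow, ← Real.rpow_natCast, ← Real.rpow_mul Real.pi_pos.le]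
    congr 1
    ring
  · have : 0 < Real.Gamma ((Fintype.card (Fin d) : ℝ) / 2 + 1) := Real.Gamma_pos_of_pos (by positivity)
    positivity

/-- the regularized profiles -/
def gapx (f : ℝ → ℝ) (n : ℕ) (t : ℝ) : ℝ :=
  if t ≤ 0 then (n : ℝ) + 1 else min (f t) n + Real.exp (-t) / ((n : ℝ) + 1)

theorem gapx_lt {f : ℝ → ℝ} (n : ℕ) {t : ℝ} (ht : 0 < t) : gapx f n t < (n : ℝ) + 1 := by
  rw [gapx, if_neg (not_le.2 ht)]
  have h1 : Real.exp (-t) / ((n : ℝ) + 1) < 1 := by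
    rw [div_lt_one (by positivity)]
    have : Real.exp (-t) < 1 := by have h0 := Real.exp_lt_exp.2 (show -t < 0 by linarith); rwa [Real.exp_zero] at h0
    have : (0:ℝ) ≤ n := n.cast_nonneg
    linarith
  linarith [min_le_right (f t) (n : ℝ)]

theorem gapx_strict {f : ℝ → ℝ} (hfa : AntitoneOn f (Set.Ioi 0)) (n : ℕ) {s t : ℝ} (ht : 0 < t)
    (hst : s < t) : gapx f n t < gapx f n s := by
  rcases le_or_gt s 0 with hs | hs
  · have : gapx f n s = n + 1 := by rw [gapx, if_pos hs]
    rw [this]; exact gapx_lt n ht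
  · rw [gapx, gapx, if_neg (not_le.2 ht), if_neg (not_le.2 hs)]
    refine add_lt_add_of_le_of_lt (min_le_min_right _ (hfa hs ht hst.le)) ?_
    have : Real.exp (-t) < Real.exp (-s) := Real.exp_lt_exp.2 (by linarith)
    gcongr

theorem gapx_anti {f : ℝ → ℝ} (hfa : AntitoneOn f (Set.Ioi 0)) (n : ℕ) : Antitone (gapx f n) := by
  intro s t hst
  rcases hst.eq_or_lt with rfl | hlt
  · exact le_rfl
  rcases le_or_gt t 0 with ht | ht
  · rw [gapx, gapx, if_pos ht, if_pos (hst.trans ht)]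
  · exact (gapx_strict hfa n ht hlt).le

theorem gapx_bd {f : ℝ → ℝ} (hf0 : ∀ t ∈ Set.Ioi (0:ℝ), 0 ≤ f t) (n : ℕ) (t : ℝ) :
    0 ≤ gapx f n t ∧ gapx f n t ≤ (n : ℝ) + 1 := by
  rcases le_or_gt t 0 with ht | ht
  · rw [gapx, if_pos ht]; exact ⟨by positivity, le_rfl⟩
  · refine ⟨?_, (gapx_lt n ht).le⟩
    rw [gapx, if_neg (not_le.2 ht)]
    have := hf0 t ht
    positivity

theorem gapx_le {f : ℝ → ℝ} (n : ℕ) {t : ℝ} (ht : 0 < t) :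
    gapx f n t ≤ f t + 1 := by
  rw [gapx, if_neg (not_le.2 ht)]
  have h1 : Real.exp (-t) / ((n : ℝ) + 1) < 1 := by
    rw [div_lt_one (by positivity)]
    have : Real.exp (-t) < 1 := by have h0 := Real.exp_lt_exp.2 (show -t < 0 by linarith); rwa [Real.exp_zero] at h0
    have : (0:ℝ) ≤ n := n.cast_nonneg
    linarith
  linarith [min_le_left (f t) (n : ℝ)]

theorem gapx_tendsto {f : ℝ → ℝ} {t : ℝ} (ht : 0 < t) :
    Tendsto (fun n => gapx f n t) atTop (𝓝 (f t)) := by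
  have h1 : Tendsto (fun n : ℕ => min (f t) (n : ℝ)) atTop (𝓝 (f t)) := by
    refine tendsto_const_nhds.congr' ?_
    filter_upwards [eventually_ge_atTop ⌈f t⌉₊] with n hn
    rw [min_eq_left ((Nat.le_ceil _).trans (by exact_mod_cast hn))]
  have h2 : Tendsto (fun n : ℕ => Real.exp (-t) / ((n : ℝ) + 1)) atTop (𝓝 0) := by
    have := (tendsto_one_div_add_atTop_nhds_zero_nat (𝕜 := ℝ)).const_mul (Real.exp (-t))
    rw [mul_zero] at this
    refine this.congr fun n => ?_
    ring
  have := h1.add h2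
  rw [add_zero] at this
  refine this.congr fun n => ?_
  rw [gapx, if_neg (not_le.2 ht)]

theorem diag_null {d : ℕ} (hd : 0 < d) (R : ℝ) :
    ∀ᵐ z : EuclideanSpace ℝ (Fin d) × EuclideanSpace ℝ (Fin d) ∂((volume.restrict
      (closedBall 0 R)).prod (volume.restrict (closedBall 0 R))), 0 < dist z.1 z.2 := by
  haveI : Nonempty (Fin d) := ⟨⟨0, hd⟩⟩
  rw [Measure.ae_prod_iff_ae_ae]
  · refine Eventually.of_forall fun x => ?_
    have : ∀ᵐ y ∂(volume.restrict (closedBall (0 : EuclideanSpace ℝ (Fin d)) R)), y ≠ x := by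
      simp [ae_iff]
    filter_upwards [this] with y hy
    exact dist_pos.2 (Ne.symm hy)
  · exact (isOpen_lt continuous_const (by fun_prop)).measurableSet

theorem lim_form {d : ℕ} (hd : 0 < d) {R m M : ℝ} (hm : 0 ≤ m) {f : ℝ → ℝ}
    (hfa : AntitoneOn f (Set.Ioi 0)) (hf0 : ∀ t ∈ Set.Ioi (0:ℝ), 0 ≤ f t)
    (hint : Integrable
      (fun z : EuclideanSpace ℝ (Fin d) × EuclideanSpace ℝ (Fin d) => f (dist z.1 z.2))
      ((volume.restrict (closedBall 0 R)).prod (volume.restrict (closedBall 0 R))))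
    {w : EuclideanSpace ℝ (Fin d) → ℝ}
    (hw : AEStronglyMeasurable w (volume.restrict (closedBall 0 R)))
    (hb : ∀ᵐ x ∂(volume.restrict (closedBall (0 : EuclideanSpace ℝ (Fin d)) R)),
      m ≤ w x ∧ w x ≤ M) :
    Tendsto (fun n => ∫ z, gapx f n (dist z.1 z.2) * (w z.1 * w z.2)
      ∂((volume.restrict (closedBall 0 R)).prod (volume.restrict (closedBall 0 R)))) atTop
      (𝓝 (∫ z, f (dist z.1 z.2) * (w z.1 * w z.2)
      ∂((volume.restrict (closedBall 0 R)).prod (volume.restrict (closedBall 0 R))))) := by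
  have hfin : IsFiniteMeasure (volume.restrict (closedBall (0 : EuclideanSpace ℝ (Fin d)) R)) :=
    ⟨by rw [Measure.restrict_apply_univ]; exact measure_closedBall_lt_top⟩
  refine tendsto_integral_of_dominated_convergence (fun z => (f (dist z.1 z.2) + 1) * M ^ 2)
    ?_ ((hint.add (integrable_const 1)).mul_const _) ?_ ?_
  · intro n
    refine AEStronglyMeasurable.mul ?_
      ((hw.comp_quasiMeasurePreserving Measure.quasiMeasurePreserving_fst).mul
        (hw.comp_quasiMeasurePreserving Measure.quasiMeasurePreserving_snd))
    exact ((gapx_anti hfa n).measurable.comp (by fun_prop)).aestronglyMeasurable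
  · intro n
    filter_upwards [diag_null hd R, wc_prod_bound hm hb] with z hz hzb
    rw [norm_mul, Real.norm_eq_abs, abs_of_nonneg (gapx_bd hf0 n _).1]
    have := hf0 _ hz
    exact mul_le_mul (gapx_le n hz) hzb (norm_nonneg _) (by linarith)
  · filter_upwards [diag_null hd R] with z hz
    exact (gapx_tendsto hz).mul_const _

/-- For the closed ball `Ω = B_{R₀}(0) ⊆ ℝ^d` and a decreasing kernel
profile `f`, the spherically decreasing bang-bang density (equal to `ρ₊` on the centered
ball of radius `r'` and `ρ₋` elsewhere) is optimal for the density problem. -/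
theorem stmt_6 (d : ℕ) (hd : 0 < d) (R₀ : ℝ) (hR₀ : 0 < R₀)
    (f : ℝ → ℝ) (hfa : AntitoneOn f (Set.Ioi 0)) (hf0 : ∀ t ∈ Set.Ioi (0:ℝ), 0 ≤ f t)
    (k : EuclideanSpace ℝ (Fin d) → EuclideanSpace ℝ (Fin d) → ℝ)
    (hk : ∀ x y, k x y = f (dist x y))
    (hint : Integrable
      (fun z : EuclideanSpace ℝ (Fin d) × EuclideanSpace ℝ (Fin d) => k z.1 z.2)
      ((volume.restrict (closedBall (0 : EuclideanSpace ℝ (Fin d)) R₀)).prod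
        (volume.restrict (closedBall (0 : EuclideanSpace ℝ (Fin d)) R₀))))
    (ρp ρm : ℝ) (hρm : 0 < ρm)
    (hρm' : ρm ≤ (volume (closedBall (0 : EuclideanSpace ℝ (Fin d)) R₀)).toReal⁻¹)
    (hρp : (volume (closedBall (0 : EuclideanSpace ℝ (Fin d)) R₀)).toReal⁻¹ ≤ ρp)
    (r' : ℝ) (hr' : r' ∈ Set.Icc 0 R₀)
    (hmass : ρp * (ballVol d * r' ^ d)
      + ρm * (ballVol d * R₀ ^ d - ballVol d * r' ^ d) = 1) :
    IsAdmissible volume (closedBall (0 : EuclideanSpace ℝ (Fin d)) R₀) ρp ρm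
      (fun x => if dist x 0 ≤ r' then ρp else ρm) ∧
    ∀ ρ, IsAdmissible volume (closedBall (0 : EuclideanSpace ℝ (Fin d)) R₀) ρp ρm ρ →
      energy volume (closedBall (0 : EuclideanSpace ℝ (Fin d)) R₀) k ρ ≤
        energy volume (closedBall (0 : EuclideanSpace ℝ (Fin d)) R₀) k
          (fun x => if dist x 0 ≤ r' then ρp else ρm) := by
  have hfin : IsFiniteMeasure (volume.restrict (closedBall (0 : EuclideanSpace ℝ (Fin d)) R₀)) :=
    ⟨by rw [Measure.restrict_apply_univ]; exact measure_closedBall_lt_top⟩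
  obtain ⟨w, hwdef⟩ : ∃ w : EuclideanSpace ℝ (Fin d) → ℝ,
    w = fun x => if dist x 0 ≤ r' then ρp else ρm := ⟨_, rfl⟩
  rw [← hwdef]
  have hmM : ρm ≤ ρp := hρm'.trans hρp
  have hwm : Measurable w := by
    rw [hwdef]
    exact Measurable.ite (isClosed_closedBall (x := (0 : EuclideanSpace ℝ (Fin d)))
      (ε := r')).measurableSet measurable_const measurable_const
  have hwb : ∀ x, ρm ≤ w x ∧ w x ≤ ρp := by
    intro x
    rw [hwdef]
    by_cases hx : dist x 0 ≤ r'
    · simp only [hx, if_true]; exact ⟨hmM, le_rfl⟩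
    · simp only [hx, if_false]; exact ⟨le_rfl, hmM⟩
  have hwmass : ∫ x in closedBall (0 : EuclideanSpace ℝ (Fin d)) R₀, w x = 1 := by
    have e : w = fun x => ρm + (closedBall (0 : EuclideanSpace ℝ (Fin d)) r').indicator
        (fun _ => ρp - ρm) x := by
      rw [hwdef]
      funext x
      by_cases hx : dist x 0 ≤ r'
      · rw [if_pos hx, indicator_of_mem (mem_closedBall.2 hx)]; ring
      · rw [if_neg hx, indicator_of_notMem (fun h => hx (mem_closedBall.1 h))]; ring
    have hms : MeasurableSet (closedBall (0 : EuclideanSpace ℝ (Fin d)) r') :=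
      isClosed_closedBall.measurableSet
    rw [e, integral_add (integrable_const _) ((integrable_const _).indicator hms),
      integral_indicator hms, Measure.restrict_restrict hms,
      inter_eq_self_of_subset_left (closedBall_subset_closedBall hr'.2), setIntegral_const,
      setIntegral_const, vol_ball_real hd hR₀.le, vol_ball_real hd hr'.1, smul_eq_mul, smul_eq_mul]
    linarith
  have hadm : IsAdmissible volume (closedBall (0 : EuclideanSpace ℝ (Fin d)) R₀) ρp ρm w :=
    ⟨hwm.aestronglyMeasurable, hwmass, Eventually.of_forall hwb⟩
  refine ⟨hadm, ?_⟩
  have hint' : Integrable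
      (fun z : EuclideanSpace ℝ (Fin d) × EuclideanSpace ℝ (Fin d) => f (dist z.1 z.2))
      ((volume.restrict (closedBall 0 R₀)).prod (volume.restrict (closedBall 0 R₀))) := by
    simpa only [hk] using hint
  have hen : ∀ ρ, IsAdmissible volume (closedBall (0 : EuclideanSpace ℝ (Fin d)) R₀) ρp ρm ρ →
      energy volume (closedBall (0 : EuclideanSpace ℝ (Fin d)) R₀) k ρ =
        (1/2 : ℝ) * ∫ z, f (dist z.1 z.2) * (ρ z.1 * ρ z.2)
      ∂((volume.restrict (closedBall 0 R₀)).prod (volume.restrict (closedBall 0 R₀))) := by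
    intro ρ hρ
    rw [energy, integral_prod _ (wc_integrable hρm.le hρ.1 hρ.2.2 hint')]
    simp only [hk, mul_assoc]
  intro ρ hρ
  rw [hen ρ hρ, hen w hadm]
  refine mul_le_mul_of_nonneg_left ?_ (by norm_num)
  refine le_of_tendsto_of_tendsto' (lim_form hd hρm.le hfa hf0 hint' hρ.1 hρ.2.2)
    (lim_form hd hρm.le hfa hf0 hint' hadm.1 hadm.2.2) fun n => ?_
  obtain ⟨u, hu, hue⟩ := radm_ae hmM hρ.1 hρ.2.1 hρ.2.2
  obtain ⟨v, hv, hve⟩ : ∃ v : EuclideanSpace ℝ (Fin d) → ℝ, RAdm R₀ ρm ρp v ∧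
      ∀ x, ‖x‖ ≤ R₀ → v x = w x := by
    have hin : ∀ x, ‖x‖ ≤ R₀ → (closedBall (0 : EuclideanSpace ℝ (Fin d)) R₀).indicator w x = w x :=
      fun x hx => indicator_of_mem (by simpa using hx) _
    have hms : MeasurableSet (closedBall (0 : EuclideanSpace ℝ (Fin d)) R₀) :=
      isClosed_closedBall.measurableSet
    refine ⟨(closedBall (0 : EuclideanSpace ℝ (Fin d)) R₀).indicator w,
      ⟨hwm.indicator hms, ?_, ?_, ?_, ?_⟩, hin⟩
    · intro x hx
      rw [hin x hx]; exact hwb x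
    · intro x hx
      exact indicator_of_notMem (by simpa using hx) _
    · rw [integrable_indicator_iff hms]
      refine Integrable.of_bound (C := ρp) hwm.aestronglyMeasurable ?_
      refine Eventually.of_forall fun x => ?_
      rw [Real.norm_eq_abs, abs_of_nonneg (hρm.le.trans (hwb x).1)]
      exact (hwb x).2
    · rw [integral_indicator hms, hwmass]
  have hcongr : ∀ {a b : EuclideanSpace ℝ (Fin d) → ℝ},
      a =ᵐ[volume.restrict (closedBall 0 R₀)] b → RAdm R₀ ρm ρp a →
      ∫ z, gapx f n (dist z.1 z.2) * (b z.1 * b z.2)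
      ∂((volume.restrict (closedBall 0 R₀)).prod (volume.restrict (closedBall 0 R₀))) =
        bform (gapx f n) a a := by
    intro a b hab ha
    rw [← bform_restrict ha]
    refine integral_congr_ae ?_
    filter_upwards [Measure.quasiMeasurePreserving_fst.ae (p := fun x => a x = b x) hab,
      Measure.quasiMeasurePreserving_snd.ae (p := fun x => a x = b x) hab] with z h1 h2
    rw [h1, h2]
  have hve' : v =ᵐ[volume.restrict (closedBall 0 R₀)] w := by
    filter_upwards [ae_restrict_mem isClosed_closedBall.measurableSet] with x hx
    exact hve x (by simpa using hx)
  rw [hcongr hue hu, hcongr hve' hv]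
  refine core_thm hR₀ hρm hmM hr'.1 (gapx_anti hfa n)
    (fun s hs t ht hst => gapx_strict hfa n (lt_of_le_of_lt hs hst) hst) (gapx_bd hf0 n) hu hv
    (fun x hx hx' => ?_) (fun x hx hx' => ?_)
  · rw [hve x hx, hwdef]
    simp only [dist_zero_right, hx', if_true]
  · rw [hve x hx, hwdef]
    simp only [dist_zero_right, not_le.2 hx', if_false]

end
end
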